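/- arXiv:2504.12886 — 11 statements merged into one kernel-verified Lean document; each statement's English description precedes it below -/
import Mathlib

section
/- Let R be a finite ring with identity and let x ∈ R. Then x is a unit of R if and only if P_x(R) = |R*| / |R|², where R* denotes the group of units of R. -/
/-- The multiplication probability of a finite ring `R` at `x`:
`P_x(R) = |{(a,b) ∈ R × R : a*b = x}| / |R|²`. -/
noncomputable def mulProb (R : Type*) [Ring R] (x : R) : ℚ :=
  (Nat.card {p : R × R // p.1 * p.2 = x} : ℚ) / (Nat.card R : ℚ) ^ 2

/-- In a finite ring `R`, an element `x` is a unit if and only if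
`P_x(R) = |R*| / |R|²`. -/
theorem isUnit_iff_mulProb_eq
    {R : Type*} [Ring R] [Finite R] (x : R) :
    IsUnit x ↔ mulProb R x = (Nat.card Rˣ : ℚ) / (Nat.card R : ℚ) ^ 2 := by
  have hR : ((Nat.card R : ℚ) ^ 2) ≠ 0 := by
    have : Nat.card R ≠ 0 := Nat.card_pos.ne'
    positivity
  unfold mulProb
  rw [div_left_inj' hR, Nat.cast_inj]
  let f : Rˣ → {p : R × R // p.1 * p.2 = x} :=
    fun u => ⟨((u : R), (↑u⁻¹ : R) * x), by simp⟩
  have hf : Function.Injective f := by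
    intro u v h
    have h1 := congrArg (fun q => q.1.1) h
    exact Units.ext h1
  constructor
  · rintro ⟨w, rfl⟩
    symm
    refine Nat.card_eq_of_bijective f ⟨hf, ?_⟩
    rintro ⟨⟨a, b⟩, hab⟩
    simp only at hab
    have h1 : a * (b * (↑w⁻¹ : R)) = 1 := by
      rw [← mul_assoc, hab, Units.mul_inv]
    have h2 : (b * (↑w⁻¹ : R)) * a = 1 := mul_eq_one_symm h1
    refine ⟨⟨a, b * (↑w⁻¹ : R), h1, h2⟩, ?_⟩
    simp [f, mul_assoc]
  · intro h
    have hb := hf.bijective_of_nat_card_le h.le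
    obtain ⟨u, hu⟩ := hb.2 ⟨(x, 1), by simp⟩
    have h1 := congrArg (fun q => q.1.1) hu
    exact ⟨u, h1⟩
end

section
/- Let R be a finite ring with identity and let x ∈ R be a nonzero element that is not a unit. Then (|R*| / |R|²) · ((2 + |Z(R)|) / |Z(R)|) ≤ P_x(R) ≤ (|R| − 2|Z(R)| + |Z(R)|²) / |R|². -/
/-- The set of zero-divisors of `R`:
`Z(R) = {x ∈ R : ∃ y ≠ 0, x*y = 0 or y*x = 0}`. -/
def zeroDivisorSet (R : Type*) [Ring R] : Set R :=
  {z : R | ∃ y : R, y ≠ 0 ∧ (z * y = 0 ∨ y * z = 0)}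

theorem aux_unit {R : Type*} [Ring R] [Finite R] {a b : R} (h : IsUnit (a * b)) :
    IsUnit a ∧ IsUnit b := by
  obtain ⟨c, hc⟩ := h.exists_right_inv
  obtain ⟨d, hd⟩ := h.exists_left_inv
  constructor
  · exact IsUnit.of_mul_eq_one (b * c) (by rw [← mul_assoc, hc])
  · exact IsUnit.of_mul_eq_one_right (d * a) (by rw [mul_assoc, hd])

theorem aux_zd {R : Type*} [Ring R] [Finite R] [Nontrivial R] (a : R) :
    a ∈ zeroDivisorSet R ↔ ¬ IsUnit a := by
  constructor
  · rintro ⟨y, hy, h | h⟩ hu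
    · exact hy (hu.mul_right_eq_zero.1 h)
    · exact hy (hu.mul_left_eq_zero.1 h)
  · intro h
    by_contra hz
    apply h
    have hinj : Function.Injective (fun b : R => a * b) := by
      intro b c hbc
      by_contra hne
      exact hz ⟨b - c, sub_ne_zero.2 hne, Or.inl (by rw [mul_sub]; exact sub_eq_zero.2 hbc)⟩
    obtain ⟨b, hb⟩ := Finite.surjective_of_injective hinj 1
    exact IsUnit.of_mul_eq_one b hb

theorem aux_card {R : Type*} [Ring R] [Finite R] (f : R →+ R) :
    Nat.card f.ker * Nat.card f.range = Nat.card R := by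
  rw [← AddSubgroup.index_ker, AddSubgroup.card_mul_index]

theorem aux_Q {R : Type*} [Ring R] [Fintype R] [DecidableEq R] (x : R) (hx0 : x ≠ 0)
    (hx : ¬ IsUnit x) : ∃ Q : Finset (R × R), Fintype.card R ≤ Q.card ∧
      ∀ p ∈ Q, ¬ IsUnit p.1 ∧ ¬ IsUnit p.2 ∧ p.1 * p.2 = 0 := by
  classical
  have h1 := aux_card (AddMonoidHom.mulRight x)
  have h2 := aux_card (AddMonoidHom.mulLeft x)
  have key1 : ∀ a r : R, a * x = 0 → ¬ IsUnit a ∧ ¬ IsUnit (x * r) ∧ a * (x * r) = 0 := by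
    intro a r h
    refine ⟨fun hu => hx0 (hu.mul_right_eq_zero.1 h), fun hu => hx (aux_unit hu).1, ?_⟩
    rw [← mul_assoc, h, zero_mul]
  have key2 : ∀ a r : R, x * a = 0 → ¬ IsUnit (r * x) ∧ ¬ IsUnit a ∧ (r * x) * a = 0 := by
    intro a r h
    refine ⟨fun hu => hx (aux_unit hu).2, fun hu => hx0 (hu.mul_left_eq_zero.1 h), ?_⟩
    rw [mul_assoc, h, mul_zero]
  simp only [Nat.card_eq_fintype_card] at h1 h2
  rcases le_total (Fintype.card (AddMonoidHom.mulRight x).range)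
    (Fintype.card (AddMonoidHom.mulLeft x).range) with h | h
  · refine ⟨((AddMonoidHom.mulRight x).ker : Set R).toFinset ×ˢ
      ((AddMonoidHom.mulLeft x).range : Set R).toFinset, ?_, ?_⟩
    · rw [Finset.card_product, Set.toFinset_card, Set.toFinset_card, ← h1]
      exact le_of_le_of_eq (Nat.mul_le_mul_left _ h) (by congr!)
    · rintro ⟨a, b⟩ hp
      simp only [Finset.mem_product, Set.mem_toFinset, SetLike.mem_coe] at hp
      obtain ⟨ha, r, rfl⟩ := hp
      exact key1 a r ha
  · refine ⟨((AddMonoidHom.mulRight x).range : Set R).toFinset ×ˢ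
      ((AddMonoidHom.mulLeft x).ker : Set R).toFinset, ?_, ?_⟩
    · rw [Finset.card_product, Set.toFinset_card, Set.toFinset_card, ← h2, mul_comm]
      exact le_of_le_of_eq (Nat.mul_le_mul_right _ h) (by congr!)
    · rintro ⟨a, b⟩ hp
      simp only [Finset.mem_product, Set.mem_toFinset, SetLike.mem_coe] at hp
      obtain ⟨⟨r, rfl⟩, hb⟩ := hp
      exact key2 b r hb

theorem aux_count {R : Type*} [Ring R] [Finite R] (x : R) (hx0 : x ≠ 0) (hx : ¬ IsUnit x) :
    Nat.card Rˣ + Nat.card (zeroDivisorSet R) = Nat.card R ∧ 2 ≤ Nat.card (zeroDivisorSet R) ∧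
    2 * Nat.card Rˣ ≤ Nat.card {p : R × R // p.1 * p.2 = x} ∧
    Nat.card {p : R × R // p.1 * p.2 = x} + Nat.card R ≤
      2 * Nat.card Rˣ + Nat.card (zeroDivisorSet R) ^ 2 := by
  classical
  have : Nontrivial R := ⟨x, 0, hx0⟩
  have := Fintype.ofFinite R
  obtain ⟨Q, hQ, hQ'⟩ := aux_Q x hx0 hx
  set Z : Finset R := Finset.univ.filter (fun a => ¬ IsUnit a) with hZ
  have hZc : Nat.card (zeroDivisorSet R) = Z.card := by
    rw [Nat.card_coe_set_eq, ← Set.ncard_coe_finset]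
    congr 1
    ext a
    simp [hZ, aux_zd]
  set S : Finset (R × R) := Finset.univ.filter (fun p => p.1 * p.2 = x) with hS
  have hSc : Nat.card {p : R × R // p.1 * p.2 = x} = S.card := by
    rw [Nat.card_eq_fintype_card, Fintype.card_subtype]
  have hU : (Finset.univ.filter (fun a : R => IsUnit a)).card = Fintype.card Rˣ := by
    rw [← Finset.card_univ (α := Rˣ), ← Finset.card_image_of_injective _ (Units.val_injective (α := R))]
    congr 1
    ext a
    rw [Finset.mem_filter]
    simp [IsUnit]
  have hUZ : Fintype.card Rˣ + Z.card = Fintype.card R := by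
    rw [← hU, hZ, Finset.card_filter_add_card_filter_not, Finset.card_univ]
  let L1 : Finset (R × R) := Finset.univ.image (fun u : Rˣ => ((u : R), (↑u⁻¹ : R) * x))
  let L2 : Finset (R × R) := Finset.univ.image (fun u : Rˣ => (x * (↑u⁻¹ : R), (u : R)))
  have hL1 : L1.card = Fintype.card Rˣ := by
    rw [Finset.card_image_of_injective, Finset.card_univ]
    intro u v h
    exact Units.ext (congrArg Prod.fst h)
  have hL2 : L2.card = Fintype.card Rˣ := by
    rw [Finset.card_image_of_injective, Finset.card_univ]
    intro u v h
    exact Units.ext (congrArg Prod.snd h)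
  have hdisj : Disjoint L1 L2 := by
    rw [Finset.disjoint_left]
    intro p h1 h2
    obtain ⟨u, -, rfl⟩ := Finset.mem_image.1 h1
    obtain ⟨v, -, hv⟩ := Finset.mem_image.1 h2
    have := congrArg Prod.fst hv
    simp only at this
    exact hx (aux_unit (this ▸ u.isUnit)).1
  have hlow : L1 ∪ L2 ⊆ S := by
    intro p hp
    rw [hS, Finset.mem_filter]
    refine ⟨Finset.mem_univ _, ?_⟩
    rcases Finset.mem_union.1 hp with h | h
    · obtain ⟨u, -, rfl⟩ := Finset.mem_image.1 h
      simp
    · obtain ⟨u, -, rfl⟩ := Finset.mem_image.1 h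
      simp
  have hQZ : Q ⊆ Z ×ˢ Z := by
    intro p hp
    obtain ⟨h1, h2, -⟩ := hQ' p hp
    simp [hZ, h1, h2]
  have hup : S ⊆ (L1 ∪ L2) ∪ ((Z ×ˢ Z) \ Q) := by
    rintro ⟨a, b⟩ hp
    have hab : a * b = x := by simpa [hS] using hp
    by_cases ha : IsUnit a
    · obtain ⟨u, rfl⟩ := ha
      refine Finset.mem_union_left _ (Finset.mem_union_left _ (Finset.mem_image.2 ⟨u, Finset.mem_univ _, ?_⟩))
      simp [← hab]
    by_cases hb : IsUnit b
    · obtain ⟨u, rfl⟩ := hb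
      refine Finset.mem_union_left _ (Finset.mem_union_right _ (Finset.mem_image.2 ⟨u, Finset.mem_univ _, ?_⟩))
      simp [← hab]
    refine Finset.mem_union_right _ (Finset.mem_sdiff.2 ⟨by simp [hZ, ha, hb], fun hq => ?_⟩)
    exact hx0 (hab.symm.trans (hQ' _ hq).2.2)
  have hU12 : (L1 ∪ L2).card = 2 * Fintype.card Rˣ := by
    rw [Finset.card_union_of_disjoint hdisj, hL1, hL2]; ring
  rw [hZc, hSc, Nat.card_eq_fintype_card, Nat.card_eq_fintype_card]
  refine ⟨hUZ, ?_, ?_, ?_⟩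
  · have : ({x, 0} : Finset R) ⊆ Z := by
      intro a ha
      rcases Finset.mem_insert.1 ha with rfl | ha
      · simp [hZ, hx]
      · rw [Finset.mem_singleton.1 ha]; simp [hZ]
    calc 2 = ({x, 0} : Finset R).card := (Finset.card_pair hx0).symm
      _ ≤ _ := Finset.card_le_card this
  · rw [← hU12]; exact Finset.card_le_card hlow
  · have h1 := (Finset.card_le_card hup).trans (Finset.card_union_le _ _)
    have h2 := Finset.card_sdiff_add_card_eq_card hQZ
    rw [Finset.card_product, ← sq] at h2
    omega

/-- If `x` is a nonzero non-unit of a finite ring `R`, then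
`(|R*|/|R|²) · ((2 + |Z(R)|)/|Z(R)|) ≤ P_x(R) ≤ (|R| − 2|Z(R)| + |Z(R)|²)/|R|²`. -/
theorem mulProb_bounds_of_ne_zero_of_not_isUnit
    {R : Type*} [Ring R] [Finite R] (x : R) (hx0 : x ≠ 0) (hx : ¬ IsUnit x) :
    (Nat.card Rˣ : ℚ) / (Nat.card R : ℚ) ^ 2 *
        ((2 + (Nat.card (zeroDivisorSet R) : ℚ)) / (Nat.card (zeroDivisorSet R) : ℚ))
      ≤ mulProb R x ∧
    mulProb R x ≤
      ((Nat.card R : ℚ) - 2 * (Nat.card (zeroDivisorSet R) : ℚ)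
          + (Nat.card (zeroDivisorSet R) : ℚ) ^ 2) / (Nat.card R : ℚ) ^ 2 := by
  obtain ⟨h1, h2, h3, h4⟩ := aux_count x hx0 hx
  have hN : 0 < Nat.card R := by omega
  unfold mulProb
  generalize Nat.card (zeroDivisorSet R) = Z at *
  generalize Nat.card {p : R × R // p.1 * p.2 = x} = S at *
  generalize Nat.card Rˣ = U at *
  generalize Nat.card R = N at *
  have hN' : (0 : ℚ) < N := by exact_mod_cast hN
  have h1' : (U : ℚ) + Z = N := by exact_mod_cast h1
  have h2' : (2 : ℚ) ≤ Z := by exact_mod_cast h2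
  have h3' : 2 * (U : ℚ) ≤ S := by exact_mod_cast h3
  have h4' : (S : ℚ) + N ≤ 2 * U + Z ^ 2 := by exact_mod_cast h4
  constructor
  · rw [div_mul_eq_mul_div]
    have hq : (2 + (Z : ℚ)) / Z ≤ 2 := by
      rw [div_le_iff₀ (by linarith)]; linarith
    have hU : (0 : ℚ) ≤ U := by positivity
    have := mul_le_mul_of_nonneg_left hq hU
    exact div_le_div_of_nonneg_right (by linarith) (by positivity)
  · exact div_le_div_of_nonneg_right (by linarith) (by positivity)
end

section
/- Let R be a finite ring with identity. Then (2|R| + |Z(R)| − 2) / |R|² ≤ P_0(R) ≤ (2|R| − 2|Z(R)| + |Z(R)|²) / |R|². -/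
theorem zd_right_aux {R : Type*} [Ring R] [Finite R] {z : R}
    (hz : z ∈ zeroDivisorSet R) : ∃ y : R, y ≠ 0 ∧ z * y = 0 := by
  obtain ⟨y, hy, h | h⟩ := hz
  · exact ⟨y, hy, h⟩
  · by_contra hc
    push Not at hc
    have hinj : Function.Injective (fun x : R => z * x) := by
      intro a b hab
      by_contra hne
      exact hc (a - b) (sub_ne_zero.mpr hne) (by rw [mul_sub]; exact sub_eq_zero.mpr hab)
    obtain ⟨w, hw⟩ := Finite.surjective_of_injective hinj 1
    apply hy
    have hw' : z * w = 1 := hw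
    calc y = y * (z * w) := by rw [hw', mul_one]
      _ = 0 := by rw [← mul_assoc, h, zero_mul]

/-- For a finite (nontrivial) ring `R`,
`(2|R| + |Z(R)| − 2)/|R|² ≤ P_0(R) ≤ (2|R| − 2|Z(R)| + |Z(R)|²)/|R|²`. -/
theorem mulProb_zero_bounds
    {R : Type*} [Ring R] [Finite R] [Nontrivial R] :
    (2 * (Nat.card R : ℚ) + (Nat.card (zeroDivisorSet R) : ℚ) - 2) / (Nat.card R : ℚ) ^ 2
      ≤ mulProb R 0 ∧
    mulProb R 0 ≤
      (2 * (Nat.card R : ℚ) - 2 * (Nat.card (zeroDivisorSet R) : ℚ)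
          + (Nat.card (zeroDivisorSet R) : ℚ) ^ 2) / (Nat.card R : ℚ) ^ 2 := by
  classical
  have := Fintype.ofFinite R
  set Z : Finset R := Finset.univ.filter (fun z => z ∈ zeroDivisorSet R) with hZ
  set S : Finset (R × R) := Finset.univ.filter (fun p => p.1 * p.2 = 0) with hS
  have cZ : Nat.card (zeroDivisorSet R) = Z.card := by
    rw [Nat.card_eq_fintype_card, hZ]
    exact Fintype.card_subtype _
  have cS : Nat.card {p : R × R // p.1 * p.2 = 0} = S.card := by
    rw [Nat.card_eq_fintype_card, hS]
    exact Fintype.card_subtype _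
  have cR : Nat.card R = Fintype.card R := Nat.card_eq_fintype_card
  have h0 : (0 : R) ∈ Z := by
    simp only [hZ, Finset.mem_filter, Finset.mem_univ, true_and]
    exact ⟨1, one_ne_zero, Or.inl (zero_mul 1)⟩
  have hy : ∀ z : R, ∃ y : R, z ∈ Z → y ≠ 0 ∧ z * y = 0 := by
    intro z
    by_cases hz : z ∈ Z
    · obtain ⟨y, h⟩ := zd_right_aux (Finset.mem_filter.mp hz).2
      exact ⟨y, fun _ => h⟩
    · exact ⟨0, fun h => absurd h hz⟩
  choose f hf using hy
  have lower : Fintype.card R + (Fintype.card R - 1) + (Z.card - 1) ≤ S.card := by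
    set A : Finset (R × R) := {0} ×ˢ Finset.univ with hA
    set B : Finset (R × R) := (Finset.univ.erase 0) ×ˢ {0} with hB
    set C : Finset (R × R) := (Z.erase 0).image (fun z => (z, f z)) with hC
    have cA : A.card = Fintype.card R := by simp [hA, Finset.card_product]
    have cB : B.card = Fintype.card R - 1 := by
      simp [hB, Finset.card_product, Finset.card_erase_of_mem]
    have cC : C.card = Z.card - 1 := by
      rw [hC, Finset.card_image_of_injective _ (fun a b h => (Prod.ext_iff.mp h).1),
        Finset.card_erase_of_mem h0]
    have dAB : Disjoint A B := by
      rw [Finset.disjoint_left]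
      rintro ⟨a, b⟩ h1 h2
      rw [hA, Finset.mem_product, Finset.mem_singleton] at h1
      rw [hB, Finset.mem_product, Finset.mem_erase] at h2
      exact h2.1.1 h1.1
    have dABC : Disjoint (A ∪ B) C := by
      rw [Finset.disjoint_left]
      rintro ⟨a, b⟩ h1 h2
      rw [hC, Finset.mem_image] at h2
      obtain ⟨z, hz, he⟩ := h2
      obtain ⟨rfl, rfl⟩ := Prod.ext_iff.mp he
      have hz' := Finset.mem_erase.mp hz
      have := hf z hz'.2
      simp [hA, hB] at h1
      rcases h1 with h1 | h1
      · exact hz'.1 (by first | exact h1 | exact h1.symm)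
      · exact this.1 (by first | exact h1.2 | exact h1.2.symm)
    rw [← cB, ← cC, ← cA, ← Finset.card_union_of_disjoint dAB,
      ← Finset.card_union_of_disjoint dABC]
    apply Finset.card_le_card
    rintro ⟨a, b⟩ h
    rw [hS, Finset.mem_filter]
    refine ⟨Finset.mem_univ _, ?_⟩
    rcases Finset.mem_union.mp h with h | h
    · rcases Finset.mem_union.mp h with h | h
      · simp [hA] at h; simp [← h]
      · simp [hB] at h; simp [← h.2]
    · rw [hC, Finset.mem_image] at h
      obtain ⟨z, hz, he⟩ := h
      obtain ⟨rfl, rfl⟩ := Prod.ext_iff.mp he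
      exact (hf z (Finset.mem_erase.mp hz).2).2
  have upper : S.card ≤ Zᶜ.card + Zᶜ.card + Z.card * Z.card := by
    have hsub : S ⊆ ({0} ×ˢ Zᶜ ∪ Zᶜ ×ˢ {0}) ∪ Z ×ˢ Z := by
      rintro ⟨a, b⟩ h
      have hab : a * b = 0 := (Finset.mem_filter.mp h).2
      have ha : b ≠ 0 → a ∈ Z := fun hb => by
        rw [hZ, Finset.mem_filter]
        exact ⟨Finset.mem_univ _, b, hb, Or.inl hab⟩
      have hb : a ≠ 0 → b ∈ Z := fun ha => by
        rw [hZ, Finset.mem_filter]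
        exact ⟨Finset.mem_univ _, a, ha, Or.inr hab⟩
      simp only [Finset.mem_union, Finset.mem_product, Finset.mem_singleton, Finset.mem_compl]
      by_cases ha0 : a = 0
      · subst ha0; tauto
      · by_cases hb0 : b = 0
        · subst hb0; tauto
        · tauto
    refine (Finset.card_le_card hsub).trans ((Finset.card_union_le _ _).trans ?_)
    have := Finset.card_union_le (({0} : Finset R) ×ˢ Zᶜ) (Zᶜ ×ˢ ({0} : Finset R))
    simp only [Finset.card_product, Finset.card_singleton, one_mul, mul_one] at this ⊢
    omega
  have hZpos : 1 ≤ Z.card := Finset.card_pos.mpr ⟨0, h0⟩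
  have hRpos : 1 ≤ Fintype.card R := Fintype.card_pos
  have hcompl : Z.card + Zᶜ.card = Fintype.card R := Finset.card_add_card_compl Z
  have l2 : 2 * Fintype.card R + Z.card ≤ S.card + 2 := by omega
  have l2q : 2 * (Fintype.card R : ℚ) + Z.card ≤ S.card + 2 := by exact_mod_cast l2
  have u2q : (S.card : ℚ) ≤ Zᶜ.card + Zᶜ.card + Z.card * Z.card := by exact_mod_cast upper
  have hcq : (Z.card : ℚ) + Zᶜ.card = Fintype.card R := by exact_mod_cast hcompl
  unfold mulProb
  rw [cZ, cS, cR]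
  constructor
  · apply div_le_div_of_nonneg_right _ (by positivity)
    linarith
  · apply div_le_div_of_nonneg_right _ (by positivity)
    nlinarith
end

section
/- Let R be a finite ring with identity and let I be a proper two-sided ideal of R. Then for any x ∈ R, P_x(R) ≤ P_{x+I}(R/I), where x + I denotes the image of x in the quotient ring R/I. -/
theorem mulProb_le_of_surjective {R S : Type*} [Ring R] [Ring S] [Finite R]
    (f : R →+* S) (hf : Function.Surjective f) (x : R) :
    mulProb R x ≤ mulProb S (f x) := by
  classical
  have : Finite S := Finite.of_surjective f hf
  choose s hs using hf
  let K := {r : R // f r = 0}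
  let e : R ≃ S × K :=
    { toFun := fun r => (f r, ⟨r - s (f r), by simp [hs]⟩)
      invFun := fun p => s p.1 + p.2.1
      left_inv := fun r => by simp
      right_inv := by
        rintro ⟨q, k, hk⟩
        simp [hs, hk] }
  have hK : 0 < Nat.card K := by
    have : Nonempty K := ⟨⟨0, map_zero f⟩⟩
    exact Nat.card_pos
  have hS : 0 < Nat.card S := Nat.card_pos
  have hR : Nat.card R = Nat.card S * Nat.card K := by
    rw [Nat.card_congr e, Nat.card_prod]
  have hc : Nat.card {p : R × R // p.1 * p.2 = x} ≤
      Nat.card {p : S × S // p.1 * p.2 = f x} * (Nat.card K * Nat.card K) := by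
    rw [← Nat.card_prod K K, ← Nat.card_prod]
    refine Nat.card_le_card_of_injective
      (fun p => (⟨(f p.1.1, f p.1.2), by simp [← map_mul, p.2]⟩,
        ((e p.1.1).2, (e p.1.2).2))) ?_
    rintro ⟨⟨a, b⟩, h⟩ ⟨⟨c, d⟩, h'⟩ hh
    simp only [Prod.mk.injEq, Subtype.mk.injEq] at hh
    obtain ⟨⟨h1, h2⟩, h3, h4⟩ := hh
    have ha : a = c := e.injective (Prod.ext h1 h3)
    have hb : b = d := e.injective (Prod.ext h2 h4)
    subst ha hb
    rfl
  unfold mulProb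
  rw [hR]
  have hK' : (0 : ℚ) < Nat.card K := by exact_mod_cast hK
  have hS' : (0 : ℚ) < Nat.card S := by exact_mod_cast hS
  have hc' : (Nat.card {p : R × R // p.1 * p.2 = x} : ℚ) ≤
      Nat.card {p : S × S // p.1 * p.2 = f x} * (Nat.card K * Nat.card K) := by
    exact_mod_cast hc
  push_cast
  rw [div_le_div_iff₀ (by positivity) (by positivity)]
  calc _ ≤ (Nat.card {p : S × S // p.1 * p.2 = f x} * (Nat.card K * Nat.card K) : ℚ)
        * (Nat.card S : ℚ) ^ 2 := by gcongr
    _ = _ := by ring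

/-- For a finite ring `R`, a proper two-sided ideal `I` of `R`, and any
`x ∈ R`, we have `P_x(R) ≤ P_{x+I}(R/I)`. -/
theorem mulProb_le_mulProb_quotient
    {R : Type*} [Ring R] [Finite R] (I : TwoSidedIdeal R) (hI : I ≠ ⊤) (x : R) :
    mulProb R x ≤ mulProb I.ringCon.Quotient (x : I.ringCon.Quotient) := by
  exact mulProb_le_of_surjective I.ringCon.mk' Quotient.mk_surjective x
end

section
/- Let F be a finite field with q elements, let n ≥ 1 be an integer, and let X ∈ Mₙ(F) be a matrix of rank r (where 0 ≤ r ≤ n). Then P_X(Mₙ(F)) = Σ_{k=r}^{n} ( ∏_{i=0}^{k-r-1} (q^{n-r} − q^i)/(q^{k-r} − q^i) · ∏_{i=0}^{k-1} (q^n − q^i) ) / q^{n(n+k)}. -/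
open Module in
lemma aux_rows {F : Type*} [Field F] {k n : ℕ} (M : Matrix (Fin k) (Fin n) F) :
    LinearIndependent F M.row ↔ LinearMap.range M.mulVecLin = ⊤ := by
  rw [linearIndependent_iff_card_eq_finrank_span, Set.finrank, ← Matrix.rank_eq_finrank_span_row,
    Matrix.rank]
  constructor
  · intro h
    apply Submodule.eq_top_of_finrank_eq
    rw [← h]; simp
  · intro h
    rw [h, finrank_top]; simp

open Module in
lemma aux_surj {F V : Type*} [Field F] [Fintype F] [AddCommGroup V] [Module F V] [Finite V]
    {n : ℕ} (W : Submodule F V) (hk : finrank F W ≤ n) :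
    Nat.card {f : (Fin n → F) →ₗ[F] V // LinearMap.range f = W} =
      ∏ i : Fin (finrank F W), (Fintype.card F ^ n - Fintype.card F ^ (i : ℕ)) := by
  have h1 := card_linearIndependent (K := F) (V := Fin n → F) (k := finrank F W) (by simpa using hk)
  rw [Module.finrank_fin_fun] at h1
  rw [← h1]
  symm
  have e : W ≃ₗ[F] (Fin (finrank F W) → F) := (finBasis F W).equivFun
  refine Nat.card_eq_of_bijective (fun s => ⟨W.subtype ∘ₗ e.symm.toLinearMap ∘ₗ
    Matrix.mulVecLin (Matrix.of s.1), ?_⟩) ⟨?_, ?_⟩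
  · have := (aux_rows (Matrix.of s.1)).1 s.2
    rw [LinearMap.range_comp, LinearMap.range_comp, this]
    simp
  · intro s t h
    simp only [Subtype.mk.injEq] at h
    apply Subtype.ext
    apply Matrix.of.injective
    apply Matrix.mulVec_injective
    funext v
    have := LinearMap.congr_fun h v
    simpa using this
  · rintro ⟨f, hf⟩
    have hm : ∀ c, f c ∈ W := fun c => hf ▸ LinearMap.mem_range_self f c
    let g := e.toLinearMap ∘ₗ f.codRestrict W hm
    have hg : Matrix.mulVecLin (LinearMap.toMatrix' g) = g := by
      rw [← Matrix.toLin'_apply', Matrix.toLin'_toMatrix']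
    refine ⟨⟨LinearMap.toMatrix' g, ?_⟩, ?_⟩
    · apply (aux_rows (LinearMap.toMatrix' g)).2
      rw [hg, LinearMap.range_comp, LinearMap.range_codRestrict, hf]
      simp
    · apply Subtype.ext
      ext1 v
      have : (Matrix.of (LinearMap.toMatrix' g)).mulVecLin = g := hg
      simp only [this]
      ext1
      simp [g]

open Module in
lemma aux_sub {F V : Type*} [Field F] [Fintype F] [AddCommGroup V] [Module F V] [Finite V]
    {d : ℕ} (hd : d ≤ finrank F V) :
    Nat.card {W : Submodule F V // finrank F W = d} *
      ∏ i : Fin d, (Fintype.card F ^ d - Fintype.card F ^ (i : ℕ)) =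
      ∏ i : Fin d, (Fintype.card F ^ (finrank F V) - Fintype.card F ^ (i : ℕ)) := by
  classical
  rw [← card_linearIndependent hd]
  let φ : {s : Fin d → V // LinearIndependent F s} → {W : Submodule F V // finrank F W = d} :=
    fun s => ⟨Submodule.span F (Set.range s.1), by simpa using finrank_span_eq_card s.2⟩
  letI : Fintype {W : Submodule F V // finrank F W = d} := Fintype.ofFinite _
  rw [← Nat.card_congr (Equiv.sigmaFiberEquiv φ), Nat.card_sigma, Nat.card_eq_fintype_card,
    ← smul_eq_mul, ← Finset.card_univ, ← Finset.sum_const]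
  refine Finset.sum_congr rfl fun W _ => ?_
  obtain ⟨W, hW⟩ := W
  have h1 := card_linearIndependent (K := F) (V := W) (k := d) hW.ge
  rw [hW] at h1
  rw [← h1]
  refine Nat.card_eq_of_bijective (fun s => ⟨⟨W.subtype ∘ s.1,
    s.2.map' _ (Submodule.ker_subtype W)⟩, ?_⟩) ⟨?_, ?_⟩
  · apply Subtype.ext
    apply Submodule.eq_of_le_of_finrank_eq
    · rw [Submodule.span_le]
      rintro _ ⟨i, rfl⟩
      exact (s.1 i).2
    · rw [hW]
      simpa using finrank_span_eq_card (s.2.map' _ (Submodule.ker_subtype W))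
  · intro s t h
    simp only [Subtype.mk.injEq] at h
    apply Subtype.ext
    funext i
    exact Subtype.ext (congrFun h i)
  · rintro ⟨⟨s, hs⟩, h⟩
    have h2 : Submodule.span F (Set.range s) = W := congrArg Subtype.val h
    have hm : ∀ i, s i ∈ W := fun i => h2 ▸ Submodule.subset_span ⟨i, rfl⟩
    refine ⟨⟨fun i => ⟨s i, hm i⟩, ?_⟩, rfl⟩
    exact LinearIndependent.of_comp W.subtype hs

open Module in
lemma aux_above {F V : Type*} [Field F] [Fintype F] [AddCommGroup V] [Module F V] [Finite V]
    (U : Submodule F V) {k : ℕ} (hk : finrank F U ≤ k) :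
    Nat.card {W : Submodule F V // U ≤ W ∧ finrank F W = k} =
    Nat.card {W : Submodule F (V ⧸ U) // finrank F W = k - finrank F U} := by
  symm
  have key : ∀ W : Submodule F (V ⧸ U),
      finrank F (W.comap U.mkQ) = finrank F W + finrank F U := by
    intro W
    have h1 := Submodule.finrank_quotient_add_finrank W
    have h2 := Submodule.finrank_quotient_add_finrank (W.comap U.mkQ)
    have h3 := Submodule.finrank_quotient_add_finrank U
    have h4 := (Submodule.quotientQuotientEquivQuotient U (W.comap U.mkQ)
      (by simpa using Submodule.le_comap_mkQ U W)).finrank_eq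
    rw [Submodule.map_comap_eq_of_surjective (Submodule.mkQ_surjective U)] at h4
    omega
  refine Nat.card_eq_of_bijective (fun W => ⟨W.1.comap U.mkQ, Submodule.le_comap_mkQ U _, ?_⟩)
    ⟨?_, ?_⟩
  · rw [key, W.2]; omega
  · intro s t h
    simp only [Subtype.mk.injEq] at h
    exact Subtype.ext (Submodule.comap_injective_of_surjective (Submodule.mkQ_surjective U) h)
  · rintro ⟨W, h1, h2⟩
    have h3 : (W.map U.mkQ).comap U.mkQ = W := by
      rw [Submodule.comap_map_mkQ]; simpa using h1
    refine ⟨⟨W.map U.mkQ, ?_⟩, Subtype.ext h3⟩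
    have := key (W.map U.mkQ)
    rw [h3] at this
    omega

open Module in
lemma aux_fib {F V : Type*} [Field F] [Fintype F] [AddCommGroup V] [Module F V] [Finite V]
    (f x : V →ₗ[F] V) (h : LinearMap.range x ≤ LinearMap.range f) :
    Nat.card {g : V →ₗ[F] V // f ∘ₗ g = x} =
      Fintype.card F ^ (finrank F V * (finrank F V - finrank F (LinearMap.range f))) := by
  obtain ⟨g0, hg0⟩ := Module.projective_lifting_property f.rangeRestrict
    (x.codRestrict (LinearMap.range f) (fun c => h (LinearMap.mem_range_self x c)))
    f.surjective_rangeRestrict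
  have hg : ∀ v, f (g0 v) = x v := fun v => congrArg Subtype.val (LinearMap.congr_fun hg0 v)
  have hk : finrank F (LinearMap.ker f) = finrank F V - finrank F (LinearMap.range f) := by
    have := f.finrank_range_add_finrank_ker
    omega
  rw [← hk, ← Module.finrank_linearMap F F V (LinearMap.ker f), ← Nat.card_eq_fintype_card,
    ← Module.natCard_eq_pow_finrank]
  symm
  refine Nat.card_eq_of_bijective (fun s => ⟨g0 + (LinearMap.ker f).subtype ∘ₗ s, ?_⟩) ⟨?_, ?_⟩
  · ext v
    simp [hg]
  · intro s t h
    simp only [Subtype.mk.injEq, add_right_inj] at h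
    ext v
    exact LinearMap.congr_fun h v
  · rintro ⟨g, h⟩
    refine ⟨(g - g0).codRestrict _ ?_, ?_⟩
    · intro v
      have := LinearMap.congr_fun h v
      simp at this
      simp [hg, this]
    · apply Subtype.ext
      ext1 v
      simp

open Module in
lemma aux_main {F : Type*} [Field F] [Fintype F] {n : ℕ}
    (x : (Fin n → F) →ₗ[F] (Fin n → F)) :
    Nat.card {p : ((Fin n → F) →ₗ[F] (Fin n → F)) × ((Fin n → F) →ₗ[F] (Fin n → F)) //
      p.1 ∘ₗ p.2 = x} =
    ∑ k ∈ Finset.Icc (finrank F (LinearMap.range x)) n,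
      Nat.card {W : Submodule F (Fin n → F) // LinearMap.range x ≤ W ∧ finrank F W = k} *
      ((∏ i : Fin k, (Fintype.card F ^ n - Fintype.card F ^ (i : ℕ))) *
        Fintype.card F ^ (n * (n - k))) := by
  classical
  haveI : Finite ((Fin n → F) →ₗ[F] (Fin n → F)) := Module.finite_of_finite F
  letI : Fintype ((Fin n → F) →ₗ[F] (Fin n → F)) := Fintype.ofFinite _
  letI : Fintype (Submodule F (Fin n → F)) := Fintype.ofFinite _
  let E : {p : ((Fin n → F) →ₗ[F] (Fin n → F)) × ((Fin n → F) →ₗ[F] (Fin n → F)) //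
      p.1 ∘ₗ p.2 = x} ≃ Σ f : (Fin n → F) →ₗ[F] (Fin n → F),
        {g : (Fin n → F) →ₗ[F] (Fin n → F) // f ∘ₗ g = x} :=
    { toFun := fun p => ⟨p.1.1, p.1.2, p.2⟩
      invFun := fun p => ⟨(p.1, p.2.1), p.2.2⟩
      left_inv := fun _ => rfl
      right_inv := fun _ => rfl }
  rw [Nat.card_congr E, Nat.card_sigma]
  have hle : ∀ W : Submodule F (Fin n → F), finrank F W ≤ n := fun W => by
    simpa using Submodule.finrank_le W
  have h1 : ∀ f : (Fin n → F) →ₗ[F] (Fin n → F),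
      Nat.card {g : (Fin n → F) →ₗ[F] (Fin n → F) // f ∘ₗ g = x} =
      if LinearMap.range x ≤ LinearMap.range f then
        Fintype.card F ^ (n * (n - finrank F (LinearMap.range f))) else 0 := by
    intro f
    split_ifs with h
    · simpa using aux_fib f x h
    · have : IsEmpty {g : (Fin n → F) →ₗ[F] (Fin n → F) // f ∘ₗ g = x} := by
        refine ⟨fun g => h ?_⟩
        rw [← g.2]
        exact LinearMap.range_comp_le_range _ _
      simp
  rw [Finset.sum_congr rfl (fun f _ => h1 f),
    ← Finset.sum_fiberwise_of_maps_to (t := Finset.univ) (g := fun f => LinearMap.range f)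
      (fun _ _ => Finset.mem_univ _)]
  have h2 : ∀ W : Submodule F (Fin n → F),
      (∑ f : (Fin n → F) →ₗ[F] (Fin n → F) with LinearMap.range f = W,
        if LinearMap.range x ≤ LinearMap.range f then
        Fintype.card F ^ (n * (n - finrank F (LinearMap.range f))) else 0) =
      if LinearMap.range x ≤ W then
        ((∏ i : Fin (finrank F W), (Fintype.card F ^ n - Fintype.card F ^ (i : ℕ))) *
        Fintype.card F ^ (n * (n - finrank F W))) else 0 := by
    intro W
    have h3 : ∀ f ∈ ({f | LinearMap.range f = W} : Finset ((Fin n → F) →ₗ[F] (Fin n → F))),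
      (if LinearMap.range x ≤ LinearMap.range f then
        Fintype.card F ^ (n * (n - finrank F (LinearMap.range f))) else 0) =
      (if LinearMap.range x ≤ W then
        Fintype.card F ^ (n * (n - finrank F W)) else 0) := by
      intro f hf
      have hf : LinearMap.range f = W := by simpa using hf
      rw [hf]
    rw [Finset.sum_congr rfl h3, Finset.sum_const, ← aux_surj W (hle W),
      Nat.card_eq_fintype_card, Fintype.card_subtype]
    split_ifs <;> simp
  rw [Finset.sum_congr rfl (fun W _ => h2 W), ← Finset.sum_filter,
    ← Finset.sum_fiberwise_of_maps_to (t := Finset.Icc (finrank F (LinearMap.range x)) n)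
      (g := fun W : Submodule F (Fin n → F) => finrank F W)]
  · refine Finset.sum_congr rfl fun k _ => ?_
    rw [Nat.card_eq_fintype_card, Fintype.card_subtype, ← smul_eq_mul, ← Finset.sum_const,
      Finset.filter_filter]
    refine Finset.sum_congr rfl fun W hW => ?_
    have : finrank F W = k := (Finset.mem_filter.1 hW).2.2
    subst this
    rfl
  · intro W hW
    have : LinearMap.range x ≤ W := by simpa using hW
    exact Finset.mem_Icc.2 ⟨Submodule.finrank_mono this, hle W⟩

lemma aux_cast (q m k : ℕ) (hq : 1 ≤ q) (hk : k ≤ m) :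
    ((∏ i : Fin k, (q ^ m - q ^ (i : ℕ)) : ℕ) : ℚ) =
      ∏ i ∈ Finset.range k, ((q : ℚ) ^ m - (q : ℚ) ^ i) := by
  rw [← Fin.prod_univ_eq_prod_range (fun i => ((q : ℚ) ^ m - (q : ℚ) ^ i)), Nat.cast_prod]
  refine Finset.prod_congr rfl fun i _ => ?_
  rw [Nat.cast_sub (Nat.pow_le_pow_right hq (by omega))]
  push_cast
  rfl


/-- For a finite field `F` with `q` elements, `n ≥ 1`, and a matrix
`X ∈ Mₙ(F)` of rank `r ≤ n`, we have
`P_X(Mₙ(F)) = Σ_{k=r}^{n} (∏_{i=0}^{k-r-1} (q^{n-r} − q^i)/(q^{k-r} − q^i)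
  · ∏_{i=0}^{k-1} (q^n − q^i)) / q^{n(n+k)}`. -/
theorem mulProb_matrix
    {F : Type*} [Field F] [Fintype F] {q n r : ℕ} (hq : Nat.card F = q) (hn : 1 ≤ n)
    (X : Matrix (Fin n) (Fin n) F) (hr : X.rank = r) (hrn : r ≤ n) :
    mulProb (Matrix (Fin n) (Fin n) F) X =
      ∑ k ∈ Finset.Icc r n,
        ((∏ i ∈ Finset.range (k - r),
            (((q : ℚ) ^ (n - r) - (q : ℚ) ^ i) / ((q : ℚ) ^ (k - r) - (q : ℚ) ^ i))) *
          ∏ i ∈ Finset.range k, ((q : ℚ) ^ n - (q : ℚ) ^ i)) / (q : ℚ) ^ (n * (n + k)) := by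
  classical
  have hqF : Fintype.card F = q := by rw [← hq, Nat.card_eq_fintype_card]
  have hq2 : 1 < q := hqF ▸ Fintype.one_lt_card
  have hq0 : (q : ℚ) ≠ 0 := by positivity
  have hx : Module.finrank F (LinearMap.range (Matrix.toLin' X)) = r := by
    rw [← hr, Matrix.toLin'_apply']; rfl
  have hc : Nat.card {p : Matrix (Fin n) (Fin n) F × Matrix (Fin n) (Fin n) F // p.1 * p.2 = X} =
      Nat.card {p : ((Fin n → F) →ₗ[F] (Fin n → F)) × ((Fin n → F) →ₗ[F] (Fin n → F)) //
        p.1 ∘ₗ p.2 = Matrix.toLin' X} := by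
    refine Nat.card_congr (Equiv.subtypeEquiv
      (Equiv.prodCongr Matrix.toLin'.toEquiv Matrix.toLin'.toEquiv) ?_)
    rintro ⟨a, b⟩
    simp [← Matrix.toLin'_mul]
  have hM : Nat.card (Matrix (Fin n) (Fin n) F) = q ^ (n * n) := by
    rw [Module.natCard_eq_pow_finrank (K := F), hq, Module.finrank_matrix]
    simp
  rw [mulProb, hc, aux_main, hx, hM, hqF, Nat.cast_sum, Finset.sum_div]
  refine Finset.sum_congr rfl fun k hk => ?_
  obtain ⟨hk1, hk2⟩ := Finset.mem_Icc.1 hk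
  have hquo : Module.finrank F ((Fin n → F) ⧸ LinearMap.range (Matrix.toLin' X)) = n - r := by
    have := Submodule.finrank_quotient_add_finrank (LinearMap.range (Matrix.toLin' X))
    rw [hx, Module.finrank_fin_fun] at this
    omega
  have hsub := aux_sub (F := F) (V := (Fin n → F) ⧸ LinearMap.range (Matrix.toLin' X))
    (d := k - r) (by omega)
  rw [hquo, hqF] at hsub
  have hab := aux_above (LinearMap.range (Matrix.toLin' X)) (k := k) (by omega)
  rw [hx] at hab
  rw [hab]
  have hsub' := congrArg (Nat.cast : ℕ → ℚ) hsub
  rw [Nat.cast_mul, aux_cast _ _ _ hq2.le le_rfl, aux_cast _ _ _ hq2.le (by omega)] at hsub'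
  have hne : ∏ i ∈ Finset.range (k - r), ((q : ℚ) ^ (k - r) - (q : ℚ) ^ i) ≠ 0 := by
    rw [Finset.prod_ne_zero_iff]
    intro i hi
    have : (q : ℚ) ^ i < (q : ℚ) ^ (k - r) :=
      pow_lt_pow_right₀ (by exact_mod_cast hq2) (Finset.mem_range.1 hi)
    exact (sub_pos.2 this).ne'
  rw [Finset.prod_div_distrib, ← hsub', mul_div_cancel_right₀ _ hne, Nat.cast_mul, Nat.cast_mul,
    aux_cast _ _ _ hq2.le hk2]
  push_cast
  rw [← mul_assoc, div_eq_div_iff (by positivity) (by positivity), mul_assoc, ← pow_add, ← pow_mul]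
  congr 2
  obtain ⟨j, rfl⟩ := Nat.exists_eq_add_of_le hk2
  rw [Nat.add_sub_cancel_left]
  ring
end

section
/- Let R be a finite local ring with identity, with |R| = q^n for some integer n ≥ 2, whose residue field R/J has q elements, where J = J(R) is the Jacobson radical. Then for every nonzero x ∈ J, ((q − 1)(q^{n−2} + 1)) / q^{2n−1} ≤ P_x(R) ≤ (q^{n−1} + q − 2)/q^{n+1}. -/
/-- The Jacobson radical of a ring, as a two-sided ideal. -/
abbrev jacobsonRadical (R : Type*) [Ring R] : TwoSidedIdeal R :=
  (⊥ : TwoSidedIdeal R).jacobson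

/-- The residue ring `R/J(R)` of a ring modulo its Jacobson radical. -/
abbrev residueRing (R : Type*) [Ring R] : Type _ :=
  (jacobsonRadical R).ringCon.Quotient

theorem mem_jac_iff {R : Type*} [Ring R] [Finite R] [IsLocalRing R] (a : R) :
    a ∈ jacobsonRadical R ↔ ¬ IsUnit a := by
  constructor
  · intro ha hu
    obtain ⟨c, hc⟩ := hu.exists_left_inv
    obtain ⟨z, hz⟩ := TwoSidedIdeal.mem_jacobson_iff.1 ha (-c)
    rw [TwoSidedIdeal.mem_bot] at hz
    have : z * -c * a + z - 1 = -1 := by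
      rw [mul_assoc, neg_mul, hc]; noncomm_ring
    rw [this] at hz
    exact one_ne_zero (neg_eq_zero.1 hz)
  · intro ha
    refine TwoSidedIdeal.mem_jacobson_iff.2 fun y => ?_
    have h1 : ¬ IsUnit (-(y * a)) := by
      intro h
      obtain ⟨c, hc⟩ := h.exists_left_inv
      exact ha (IsUnit.of_mul_eq_one_right (-(c * y)) (by rw [← hc]; noncomm_ring))
    have h2 : IsUnit (1 + y * a) := by
      have := IsLocalRing.isUnit_or_isUnit_of_add_one (a := -(y * a)) (b := 1 + y * a) (by abel)
      exact this.resolve_left h1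
    obtain ⟨z, hz⟩ := h2.exists_left_inv
    refine ⟨z, ?_⟩
    rw [TwoSidedIdeal.mem_bot, ← hz]
    noncomm_ring

theorem exists_section {R : Type*} [Ring R] [Finite R] [IsLocalRing R] :
    ∃ s : residueRing R → R, (∀ c d, ¬ IsUnit (s c - s d) → c = d) ∧
      (∀ a, ∃ c, ¬ IsUnit (a - s c)) := by
  refine ⟨Quotient.out, ?_, ?_⟩
  · intro c d h
    rw [← mem_jac_iff, ← TwoSidedIdeal.rel_iff] at h
    exact Quotient.out_equiv_out.1 h
  · intro a
    refine ⟨Quotient.mk _ a, ?_⟩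
    rw [← mem_jac_iff, ← TwoSidedIdeal.rel_iff]
    exact Setoid.symm' (jacobsonRadical R).ringCon.toSetoid (Quotient.mk_out (s := (jacobsonRadical R).ringCon.toSetoid) a)

section
variable {R : Type*} [Ring R] [Finite R] [IsLocalRing R]

theorem nu_add {a b : R} (ha : ¬ IsUnit a) (hb : ¬ IsUnit b) : ¬ IsUnit (a + b) := by
  rw [← mem_jac_iff] at *; exact TwoSidedIdeal.add_mem _ ha hb

theorem nu_neg {a : R} (ha : ¬ IsUnit a) : ¬ IsUnit (-a) := by
  rw [← mem_jac_iff] at *; exact TwoSidedIdeal.neg_mem _ ha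

theorem nu_mul_right {a : R} (b : R) (ha : ¬ IsUnit a) : ¬ IsUnit (a * b) := by
  rw [← mem_jac_iff] at *; exact TwoSidedIdeal.mul_mem_right _ _ _ ha

theorem nu_mul_left {b : R} (a : R) (hb : ¬ IsUnit b) : ¬ IsUnit (a * b) := by
  rw [← mem_jac_iff] at *; exact TwoSidedIdeal.mul_mem_left _ _ _ hb

theorem nu_of_mul_eq {x c d : R} (hx : x ≠ 0) (h : x * c = x * d) : ¬ IsUnit (c - d) := by
  intro hu
  have : x * (c - d) = 0 := by rw [mul_sub, h, sub_self]
  exact hx ((hu.mul_left_eq_zero).1 this)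

theorem card_R_eq : Nat.card R = Nat.card (residueRing R) * Nat.card {a : R // ¬ IsUnit a} := by
  obtain ⟨s, hs, hs'⟩ := exists_section (R := R)
  rw [← Nat.card_prod]
  symm
  refine Nat.card_congr (Equiv.ofBijective (fun p => s p.1 + p.2.1) ⟨?_, ?_⟩)
  · rintro ⟨c, a, ha⟩ ⟨d, b, hb⟩ h
    simp only at h
    have h1 : s c - s d = b + -a := by
      rw [← sub_eq_add_neg, sub_eq_sub_iff_add_eq_add, h, add_comm]
    have h2 := hs c d (by rw [h1]; exact nu_add hb (nu_neg ha))
    subst h2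
    simpa using h
  · intro a
    obtain ⟨c, hc⟩ := hs' a
    exact ⟨(c, ⟨_, hc⟩), by simp⟩

theorem fibre_bound {x : R} (hx : x ≠ 0) {a b₀ : R} (hb₀ : ¬ IsUnit b₀)
    (h : a * b₀ = x) :
    Nat.card (residueRing R) * Nat.card {b : R // ¬ IsUnit b ∧ a * b = x} ≤
      Nat.card {a : R // ¬ IsUnit a} := by
  obtain ⟨s, hs, hs'⟩ := exists_section (R := R)
  rw [← Nat.card_prod]
  refine Nat.card_le_card_of_injective (fun p => (⟨p.2.1 + b₀ * (s p.1 - 1),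
    nu_add p.2.2.1 (nu_mul_right _ hb₀)⟩ : {a : R // ¬ IsUnit a})) ?_
  rintro ⟨c, b, hb, hab⟩ ⟨d, b', hb', hab'⟩ e
  simp only [Subtype.mk.injEq] at e
  have e2 := congrArg (a * ·) e
  simp only [mul_add, ← mul_assoc, h, hab, hab', mul_sub, mul_one, add_sub_cancel] at e2
  have := hs c d (nu_of_mul_eq hx e2)
  subst this
  simpa using e

theorem sq_bound {x : R} (hx : x ≠ 0) {a b₀ : R} (ha : ¬ IsUnit a) (hb₀ : ¬ IsUnit b₀)
    (h : a * b₀ = x) :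
    Nat.card (residueRing R) * Nat.card (residueRing R) ≤ Nat.card {a : R // ¬ IsUnit a} := by
  obtain ⟨s, hs, hs'⟩ := exists_section (R := R)
  obtain ⟨y, hy, hay⟩ : ∃ y, y ≠ 0 ∧ a * y = 0 := by
    by_contra hcon
    push Not at hcon
    have hinj : Function.Injective (fun y => a * y) := by
      intro u v huv
      by_contra hne
      exact hcon (u - v) (sub_ne_zero.2 hne) (by rw [mul_sub]; exact sub_eq_zero.2 huv)
    obtain ⟨z, hz⟩ := (Finite.injective_iff_surjective.1 hinj) 1
    exact ha (IsUnit.of_mul_eq_one z hz)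
  have hyn : ¬ IsUnit y := by
    intro hu
    have ha0 := (hu.mul_left_eq_zero).1 hay
    exact hx (by rw [← h, ha0, zero_mul])
  rw [← Nat.card_prod]
  refine Nat.card_le_card_of_injective (fun p => (⟨b₀ * s p.1 + y * s p.2,
    nu_add (nu_mul_right _ hb₀) (nu_mul_right _ hyn)⟩ : {a : R // ¬ IsUnit a})) ?_
  rintro ⟨c, c'⟩ ⟨d, d'⟩ e
  simp only [Subtype.mk.injEq] at e
  have e2 := congrArg (a * ·) e
  simp only [mul_add, ← mul_assoc, h, hay, zero_mul, add_zero] at e2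
  have := hs c d (nu_of_mul_eq hx e2)
  subst this
  have := hs c' d' (nu_of_mul_eq hy (add_left_cancel e))
  subst this
  rfl

theorem card_pairs {x : R} (hx : ¬ IsUnit x) :
    Nat.card {p : R × R // p.1 * p.2 = x} = 2 * Nat.card {a : R // IsUnit a} +
      Nat.card {p : R × R // (¬ IsUnit p.1 ∧ ¬ IsUnit p.2) ∧ p.1 * p.2 = x} := by
  classical
  have := Fintype.ofFinite R
  have e1 : Nat.card {a : R // IsUnit a} = Nat.card {p : R × R // IsUnit p.1 ∧ p.1 * p.2 = x} := by
    refine (Nat.card_congr (Equiv.ofBijective (fun p => ⟨p.1.1, p.2.1⟩) ⟨?_, ?_⟩)).symm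
    · rintro ⟨⟨a, b⟩, h1, h2⟩ ⟨⟨c, d⟩, h3, h4⟩ e
      simp only [Subtype.mk.injEq] at e h1 h2 h4
      subst e
      have := h1.mul_left_cancel (h2.trans h4.symm)
      subst this; rfl
    · rintro ⟨a, ha⟩
      obtain ⟨c, hc⟩ := ha.exists_right_inv
      exact ⟨⟨(a, c * x), ha, by simp [← mul_assoc, hc]⟩, rfl⟩
  have e2 : Nat.card {a : R // IsUnit a} = Nat.card {p : R × R // IsUnit p.2 ∧ p.1 * p.2 = x} := by
    refine (Nat.card_congr (Equiv.ofBijective (fun p => ⟨p.1.2, p.2.1⟩) ⟨?_, ?_⟩)).symm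
    · rintro ⟨⟨a, b⟩, h1, h2⟩ ⟨⟨c, d⟩, h3, h4⟩ e
      simp only [Subtype.mk.injEq] at e h1 h2 h4
      subst e
      have := h1.mul_right_cancel (h2.trans h4.symm)
      subst this; rfl
    · rintro ⟨a, ha⟩
      obtain ⟨c, hc⟩ := ha.exists_left_inv
      exact ⟨⟨(x * c, a), ha, by simp [mul_assoc, hc]⟩, rfl⟩
  rw [two_mul]
  nth_rw 1 [e1]
  rw [e2]
  simp only [Nat.card_eq_fintype_card, Fintype.card_subtype]
  rw [← Finset.card_union_of_disjoint, ← Finset.card_union_of_disjoint]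
  · congr 1
    ext p
    simp only [Finset.mem_filter, Finset.mem_univ, true_and, Finset.mem_union]
    tauto
  · rw [Finset.disjoint_left]
    intro p
    simp only [Finset.mem_filter, Finset.mem_univ, true_and, Finset.mem_union]
    tauto
  · rw [Finset.disjoint_left]
    rintro p h1 h2
    simp only [Finset.mem_filter, Finset.mem_univ, true_and] at h1 h2
    exact hx (by rw [← h1.2]; exact h1.1.mul h2.1)

theorem card_M {x : R} (k : ℕ)
    (hk : ∀ a : R, Nat.card {b : R // ¬ IsUnit b ∧ a * b = x} ≤ k) :
    Nat.card {p : R × R // (¬ IsUnit p.1 ∧ ¬ IsUnit p.2) ∧ p.1 * p.2 = x} ≤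
      Nat.card {a : R // ¬ IsUnit a} * k := by
  classical
  have := Fintype.ofFinite R
  have e : {p : R × R // (¬ IsUnit p.1 ∧ ¬ IsUnit p.2) ∧ p.1 * p.2 = x} ≃
      Σ a : {a : R // ¬ IsUnit a}, {b : R // ¬ IsUnit b ∧ a.1 * b = x} :=
    { toFun := fun p => ⟨⟨p.1.1, p.2.1.1⟩, ⟨p.1.2, p.2.1.2, p.2.2⟩⟩
      invFun := fun p => ⟨(p.1.1, p.2.1), ⟨p.1.2, p.2.2.1⟩, p.2.2.2⟩
      left_inv := fun _ => rfl
      right_inv := fun _ => rfl }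
  rw [Nat.card_congr e, Nat.card_sigma, Nat.card_eq_fintype_card (α := {a : R // ¬ IsUnit a})]
  refine (Finset.sum_le_card_nsmul _ _ k fun a _ => hk a.1).trans ?_
  simp

end

/-- Let `R` be a finite local ring with `|R| = qⁿ`, `n ≥ 2`, whose residue
field `R/J` has `q` elements. Then for every nonzero `x ∈ J`,
`(q − 1)(q^{n−2} + 1)/q^{2n−1} ≤ P_x(R) ≤ (q^{n−1} + q − 2)/q^{n+1}`. -/
theorem mulProb_bounds_local_radical
    {R : Type*} [Ring R] [Finite R] [IsLocalRing R] {q n : ℕ} (hn : 2 ≤ n)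
    (hcard : Nat.card R = q ^ n) (hres : Nat.card (residueRing R) = q)
    (x : R) (hxJ : x ∈ jacobsonRadical R) (hx0 : x ≠ 0) :
    ((q : ℚ) - 1) * ((q : ℚ) ^ (n - 2) + 1) / (q : ℚ) ^ (2 * n - 1) ≤ mulProb R x ∧
    mulProb R x ≤ ((q : ℚ) ^ (n - 1) + (q : ℚ) - 2) / (q : ℚ) ^ (n + 1) := by
  have hxu := (mem_jac_iff x).1 hxJ
  obtain ⟨m, rfl⟩ : ∃ m, n = m + 2 := ⟨n - 2, by omega⟩
  have hR := card_R_eq (R := R)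
  have hq2 : 2 ≤ q := by
    have h1 : 1 < Nat.card R := Finite.one_lt_card
    rw [hcard] at h1
    rcases q with _ | _ | q
    · simp at h1
    · simp at h1
    · omega
  rw [hcard, hres] at hR
  have hJ : Nat.card {a : R // ¬ IsUnit a} = q ^ (m + 1) := by
    apply Nat.eq_of_mul_eq_mul_left (show 0 < q by omega)
    rw [← hR]; ring
  have hU : Nat.card {a : R // IsUnit a} + q ^ (m + 1) = q ^ (m + 2) := by
    classical
    have := Fintype.ofFinite R
    rw [← hJ, ← hcard]
    simp only [Nat.card_eq_fintype_card]
    rw [Fintype.card_subtype_compl]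
    exact Nat.add_sub_cancel' (Fintype.card_subtype_le _)
  have hN := card_pairs hxu
  set M := Nat.card {p : R × R // (¬ IsUnit p.1 ∧ ¬ IsUnit p.2) ∧ p.1 * p.2 = x} with hMdef
  set U := Nat.card {a : R // IsUnit a}
  set N := Nat.card {p : R × R // p.1 * p.2 = x} with hNdef
  have hM1 : M ≤ q ^ (m + 1) * q ^ m := by
    rw [← hJ]
    refine card_M _ fun a => ?_
    by_cases hne : ∃ b₀ : R, ¬ IsUnit b₀ ∧ a * b₀ = x
    · obtain ⟨b₀, hb₀, h⟩ := hne
      have := fibre_bound hx0 hb₀ h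
      rw [hres, hJ, pow_succ, mul_comm _ q] at this
      exact Nat.le_of_mul_le_mul_left this (by omega)
    · have : IsEmpty {b : R // ¬ IsUnit b ∧ a * b = x} := ⟨fun b => hne ⟨b.1, b.2⟩⟩
      simp
  have hM : M + q ^ (m + 1) * q ≤ q ^ (m + 1) * q ^ (m + 1) := by
    by_cases hne : ∃ p : R × R, (¬ IsUnit p.1 ∧ ¬ IsUnit p.2) ∧ p.1 * p.2 = x
    · obtain ⟨⟨a, b⟩, ⟨ha, hb⟩, h⟩ := hne
      have h3 := sq_bound hx0 ha hb h
      rw [hres, hJ, pow_succ] at h3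
      have h4 : q ≤ q ^ m := Nat.le_of_mul_le_mul_right h3 (by omega)
      have h5 : q ^ m + q ≤ q ^ (m + 1) := by rw [pow_succ]; nlinarith
      calc _ ≤ q ^ (m + 1) * q ^ m + q ^ (m + 1) * q := by omega
        _ = q ^ (m + 1) * (q ^ m + q) := by ring
        _ ≤ _ := Nat.mul_le_mul_left _ h5
    · have : IsEmpty {p : R × R // (¬ IsUnit p.1 ∧ ¬ IsUnit p.2) ∧ p.1 * p.2 = x} :=
        ⟨fun b => hne ⟨b.1, b.2⟩⟩
      have hM0 : M = 0 := by rw [hMdef]; simp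
      rw [hM0, zero_add]
      refine Nat.mul_le_mul_left _ ?_
      exact Nat.le_self_pow (by omega) q
  have hqQ : (2 : ℚ) ≤ q := by exact_mod_cast hq2
  have hq0 : (0 : ℚ) < q := by linarith
  have hUQ : (U : ℚ) + (q : ℚ) ^ (m + 1) = (q : ℚ) ^ (m + 2) := by exact_mod_cast hU
  have hNQ : (N : ℚ) = 2 * U + M := by exact_mod_cast hN
  have hMQ : (M : ℚ) + (q : ℚ) ^ (m + 1) * q ≤ (q : ℚ) ^ (m + 1) * (q : ℚ) ^ (m + 1) := by
    exact_mod_cast hM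
  have hM0 : (0 : ℚ) ≤ M := Nat.cast_nonneg _
  have hp1 : (1 : ℚ) ≤ (q : ℚ) ^ m := one_le_pow₀ (by linarith)
  have hP : mulProb R x = (N : ℚ) / ((q : ℚ) ^ (m + 2)) ^ 2 := by
    rw [mulProb, hcard]; push_cast; rfl
  have a1 : m + 2 - 2 = m := by omega
  have a2 : 2 * (m + 2) - 1 = 2 * m + 3 := by omega
  have a3 : m + 2 - 1 = m + 1 := by omega
  rw [hP, a1, a2, a3]
  have hUe : (U : ℚ) = (q : ℚ) * (q - 1) * (q : ℚ) ^ m := by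
    rw [pow_add, pow_add] at hUQ; linarith
  constructor
  · rw [div_le_div_iff₀ (by positivity) (by positivity)]
    have e : ((q : ℚ) ^ (m + 2)) ^ 2 = q * (q : ℚ) ^ (2 * m + 3) := by ring
    rw [e, ← mul_assoc]
    refine mul_le_mul_of_nonneg_right ?_ (by positivity)
    rw [hNQ, hUe]
    have : 0 ≤ (q : ℚ) * (q - 1) * ((q : ℚ) ^ m - 1) :=
      mul_nonneg (mul_nonneg hq0.le (by linarith)) (by linarith)
    linarith
  · rw [div_le_div_iff₀ (by positivity) (by positivity)]
    have e : ((q : ℚ) ^ (m + 2)) ^ 2 = q ^ (m + 1) * (q : ℚ) ^ (m + 2 + 1) := by ring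
    rw [e, ← mul_assoc]
    refine mul_le_mul_of_nonneg_right ?_ (by positivity)
    rw [hNQ, hUe]
    rw [pow_succ] at hMQ ⊢
    linarith
end

section
/- Let R be a finite local ring with identity, with |R| = q^n for some integer n ≥ 2, whose residue field R/J has q elements, where J = J(R) is the Jacobson radical. Then (3q^{n−1} − q^{n−2} − 1)/q^{2n−1} ≤ P_0(R) ≤ (q^{n−1} + 2q − 2)/q^{n+1}. -/
theorem aux_mem_iff {R : Type*} [Ring R] [Finite R] [IsLocalRing R] (x : R) :
    x ∈ jacobsonRadical R ↔ ¬ IsUnit x := by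
  rw [TwoSidedIdeal.mem_jacobson_iff]
  constructor
  · rintro h ⟨u, rfl⟩
    obtain ⟨z, hz⟩ := h (-(↑u⁻¹ : R))
    rw [TwoSidedIdeal.mem_bot] at hz
    have : z * -(↑u⁻¹ : R) * u = -z := by rw [mul_neg, neg_mul, Units.inv_mul_cancel_right]
    rw [this] at hz
    simp at hz
  · intro h y
    have h1 : IsUnit (-(y * x)) ∨ IsUnit (y * x + 1) :=
      IsLocalRing.isUnit_or_isUnit_of_add_one (by simp)
    rcases h1 with h1 | ⟨u, hu⟩
    · exfalso
      obtain ⟨u, hu⟩ := h1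
      apply h
      have e : (-(↑u⁻¹ : R) * y) * x = 1 := by
        rw [mul_assoc, neg_mul, ← mul_neg, ← hu, Units.inv_mul]
      exact ⟨⟨x, _, mul_eq_one_symm e, e⟩, rfl⟩
    · refine ⟨(↑u⁻¹ : R), ?_⟩
      rw [TwoSidedIdeal.mem_bot, mul_assoc, ← mul_add_one, ← hu, Units.inv_mul, sub_self]

theorem aux_card_s10 {R : Type*} [Ring R] [Finite R] :
    Nat.card R = Nat.card {x : R // x ∈ jacobsonRadical R} * Nat.card (residueRing R) := by
  let f : R →+ residueRing R := ((jacobsonRadical R).ringCon.mk' : R →+* _).toAddMonoidHom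
  have hs : Function.Surjective f := RingCon.mk'_surjective _
  have h1 := f.ker.card_mul_index
  rw [AddSubgroup.index_ker, AddMonoidHom.range_eq_top.mpr hs, AddSubgroup.card_top] at h1
  rw [← h1]
  congr 1
  apply Nat.card_congr
  refine Equiv.subtypeEquivRight fun x => ?_
  rw [AddMonoidHom.mem_ker, TwoSidedIdeal.mem_iff]
  exact RingCon.eq _

theorem aux_ann {R : Type*} [Ring R] [Finite R] (a : R) :
    Nat.card {b : R // a * b = 0} * Nat.card (AddMonoidHom.mulLeft a).range = Nat.card R := by
  have h1 := (AddMonoidHom.mulLeft a).ker.card_mul_index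
  rw [AddSubgroup.index_ker] at h1
  exact h1

/-- Let `R` be a finite local ring with `|R| = qⁿ`, `n ≥ 2`, whose residue
field `R/J` has `q` elements. Then
`(3q^{n−1} − q^{n−2} − 1)/q^{2n−1} ≤ P_0(R) ≤ (q^{n−1} + 2q − 2)/q^{n+1}`. -/
theorem mulProb_zero_bounds_local
    {R : Type*} [Ring R] [Finite R] [IsLocalRing R] {q n : ℕ} (hn : 2 ≤ n)
    (hcard : Nat.card R = q ^ n) (hres : Nat.card (residueRing R) = q) :
    (3 * (q : ℚ) ^ (n - 1) - (q : ℚ) ^ (n - 2) - 1) / (q : ℚ) ^ (2 * n - 1) ≤ mulProb R 0 ∧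
    mulProb R 0 ≤ ((q : ℚ) ^ (n - 1) + 2 * (q : ℚ) - 2) / (q : ℚ) ^ (n + 1) := by
  classical
  have := Fintype.ofFinite R
  obtain ⟨k, rfl⟩ := Nat.exists_eq_add_of_le' hn
  have hq : 0 < q := by
    rcases Nat.eq_zero_or_pos q with h | h
    · subst h
      have : 0 < Nat.card R := Nat.card_pos
      rw [hcard] at this; simp at this
    · exact h
  have hJ : Nat.card {x : R // x ∈ jacobsonRadical R} = q ^ (k + 1) := by
    have h := aux_card_s10 (R := R)
    rw [hcard, hres, pow_succ] at h
    exact (Nat.eq_of_mul_eq_mul_right hq h).symm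
  set c : R → ℕ := fun a => Nat.card {b : R // a * b = 0} with hc
  have hN : Nat.card {p : R × R // p.1 * p.2 = 0} = ∑ a, c a := by
    rw [← Nat.card_sigma]
    exact Nat.card_congr
      ⟨fun p => ⟨p.1.1, p.1.2, p.2⟩, fun s => ⟨(s.1, s.2.1), s.2.2⟩, fun _ => rfl, fun _ => rfl⟩
  have hc0 : c 0 = q ^ (k + 2) := by
    rw [← hcard]
    exact Nat.card_congr (Equiv.subtypeUnivEquiv fun b => zero_mul b)
  have hcu : ∀ a : R, IsUnit a → c a = 1 := by
    intro a ha
    rw [hc, Nat.card_eq_one_iff_unique]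
    refine ⟨⟨fun x y => Subtype.ext ?_⟩, ⟨0, mul_zero a⟩⟩
    rw [ha.mul_right_eq_zero.mp x.2, ha.mul_right_eq_zero.mp y.2]
  have hup : ∀ a : R, a ≠ 0 → c a ≤ q ^ (k + 1) := by
    intro a ha
    rw [← hJ]
    refine Nat.card_le_card_of_injective
      (fun b => (⟨b.1, (aux_mem_iff _).2 fun hb => ha (hb.mul_left_eq_zero.mp b.2)⟩ :
        {x : R // x ∈ jacobsonRadical R})) ?_
    intro x y h
    exact Subtype.ext (congrArg (fun z : {x : R // x ∈ jacobsonRadical R} => z.1) h)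
  have hlo : ∀ a : R, a ∈ jacobsonRadical R → q ≤ c a := by
    intro a ha
    have h1 := aux_ann a
    have h2 : Nat.card (AddMonoidHom.mulLeft a).range ≤ q ^ (k + 1) := by
      rw [← hJ]
      refine Nat.card_le_card_of_injective
        (fun b => (⟨b.1, ?_⟩ : {x : R // x ∈ jacobsonRadical R})) ?_
      · obtain ⟨_, r, rfl⟩ := b
        exact TwoSidedIdeal.mul_mem_right _ _ _ ha
      · intro x y h
        exact Subtype.ext (congrArg (fun z : {x : R // x ∈ jacobsonRadical R} => z.1) h)
    rw [hcard] at h1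
    have h3 : q * q ^ (k + 1) ≤ c a * q ^ (k + 1) := by
      calc q * q ^ (k + 1) = q ^ (k + 2) := by ring
        _ = c a * _ := h1.symm
        _ ≤ _ := Nat.mul_le_mul_left _ h2
    exact Nat.le_of_mul_le_mul_right h3 (by positivity)
  have hsum : ∀ s t : ℚ, ∑ a : R, (1 + (if a ∈ jacobsonRadical R then s else 0)
      + (if a = 0 then t else 0)) = (q : ℚ) ^ (k + 2) + (q : ℚ) ^ (k + 1) * s + t := by
    intro s t
    have e1 : Fintype.card R = q ^ (k + 2) := by rw [← Nat.card_eq_fintype_card, hcard]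
    have e2 : (Finset.univ.filter fun a : R => a ∈ jacobsonRadical R).card = q ^ (k + 1) := by
      rw [← hJ, Nat.card_eq_fintype_card, Fintype.card_subtype]
    rw [Finset.sum_add_distrib, Finset.sum_add_distrib, ← Finset.sum_filter, Finset.sum_const,
      Finset.sum_const, e2, Finset.card_univ, e1]
    simp
  have hJ0 : (0 : R) ∈ jacobsonRadical R := zero_mem _
  have hL : (q : ℚ) ^ (k + 2) + (q : ℚ) ^ (k + 1) * (q - 1) + (q ^ (k + 2) - q)
      ≤ ((∑ a, c a : ℕ) : ℚ) := by
    rw [← hsum, Nat.cast_sum]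
    refine Finset.sum_le_sum fun a _ => ?_
    by_cases h0 : a = 0
    · subst h0
      rw [hc0, if_pos hJ0, if_pos rfl]; push_cast; linarith
    · by_cases hj : a ∈ jacobsonRadical R
      · have : (q : ℚ) ≤ c a := by exact_mod_cast hlo a hj
        rw [if_pos hj, if_neg h0]; linarith
      · rw [hcu a (by simpa [aux_mem_iff] using hj), if_neg hj, if_neg h0]; simp
  have hU : ((∑ a, c a : ℕ) : ℚ) ≤ (q : ℚ) ^ (k + 2) + (q : ℚ) ^ (k + 1) * (q ^ (k + 1) - 1)
      + (q ^ (k + 2) - q ^ (k + 1)) := by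
    rw [← hsum, Nat.cast_sum]
    refine Finset.sum_le_sum fun a _ => ?_
    by_cases h0 : a = 0
    · subst h0
      rw [hc0, if_pos hJ0, if_pos rfl]; push_cast; linarith
    · by_cases hj : a ∈ jacobsonRadical R
      · have : (c a : ℚ) ≤ q ^ (k + 1) := by exact_mod_cast hup a h0
        rw [if_pos hj, if_neg h0]; linarith
      · rw [hcu a (by simpa [aux_mem_iff] using hj), if_neg hj, if_neg h0]; simp
  have hq' : (0 : ℚ) < q := by exact_mod_cast hq
  unfold mulProb
  rw [hN, hcard, show k + 2 - 1 = k + 1 by omega, show k + 2 - 2 = k by omega,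
    show 2 * (k + 2) - 1 = 2 * k + 3 by omega]
  push_cast at hL hU ⊢
  constructor
  · have e : (3 * (q : ℚ) ^ (k + 1) - (q : ℚ) ^ k - 1) / (q : ℚ) ^ (2 * k + 3)
        = ((q : ℚ) ^ (k + 2) + (q : ℚ) ^ (k + 1) * (q - 1) + (q ^ (k + 2) - q))
          / ((q : ℚ) ^ (k + 2)) ^ 2 := by
      rw [div_eq_div_iff (by positivity) (by positivity)]; ring
    rw [e]
    exact div_le_div_of_nonneg_right hL (by positivity)
  · have e : ((q : ℚ) ^ (k + 1) + 2 * q - 2) / (q : ℚ) ^ (k + 2 + 1)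
        = ((q : ℚ) ^ (k + 2) + (q : ℚ) ^ (k + 1) * (q ^ (k + 1) - 1)
          + (q ^ (k + 2) - q ^ (k + 1))) / ((q : ℚ) ^ (k + 2)) ^ 2 := by
      rw [div_eq_div_iff (by positivity) (by positivity)]; ring
    rw [e]
    exact div_le_div_of_nonneg_right hU (by positivity)
end

section
/- Let R be a finite local ring with identity, with |R| = q^n for some integer n ≥ 2, whose residue field R/J has q elements, where J = J(R) is the Jacobson radical. Then P_0(R) = (3q^{n−1} − q^{n−2} − 1)/q^{2n−1} if and only if |R| = q² (that is, n = 2). -/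
namespace MulProbAux

variable {R : Type*} [Ring R]

/-- right annihilator -/
def ann (a : R) : AddSubgroup R := (AddMonoidHom.mulLeft a).ker

lemma mem_ann {a b : R} : b ∈ ann a ↔ a * b = 0 := by
  simp [ann, AddMonoidHom.mem_ker]

lemma isUnit_of_mul_one [Finite R] {a b : R} (h : a * b = 1) : IsUnit a ∧ IsUnit b := by
  have h2 : b * a = 1 := mul_eq_one_symm h
  exact ⟨⟨⟨a, b, h, h2⟩, rfl⟩, ⟨⟨b, a, h2, h⟩, rfl⟩⟩

lemma isUnit_of_mul_left [Finite R] {a b : R} (h : IsUnit (a * b)) : IsUnit a := by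
  obtain ⟨c, hc⟩ := h.exists_right_inv
  exact (isUnit_of_mul_one (a := a) (b := b * c) (by rw [← mul_assoc, hc])).1

lemma isUnit_of_mul_right [Finite R] {a b : R} (h : IsUnit (a * b)) : IsUnit b := by
  obtain ⟨c, hc⟩ := h.exists_left_inv
  exact (isUnit_of_mul_one (a := c * a) (b := b) (by rw [mul_assoc, hc])).2

lemma mem_J [Finite R] [IsLocalRing R] {x : R} : x ∈ jacobsonRadical R ↔ ¬ IsUnit x := by
  rw [TwoSidedIdeal.mem_jacobson_iff]
  constructor
  · rintro h ⟨u, rfl⟩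
    obtain ⟨z, hz⟩ := h (-(↑u⁻¹ : R))
    rw [TwoSidedIdeal.mem_bot] at hz
    simp at hz
  · intro hx y
    have h1 : IsUnit (1 + y * x) := by
      have := IsLocalRing.isUnit_or_isUnit_of_add_one (R := R) (a := 1 + y * x) (b := -(y * x))
        (by abel)
      rcases this with h | h
      · exact h
      · exact absurd (isUnit_of_mul_right (IsUnit.neg_iff _ |>.1 h)) hx
    obtain ⟨z, hz⟩ := h1.exists_left_inv
    refine ⟨z, ?_⟩
    rw [TwoSidedIdeal.mem_bot, sub_eq_zero, ← hz]
    noncomm_ring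

/-- radical as additive subgroup -/
def J (R : Type*) [Ring R] : AddSubgroup R :=
  ((jacobsonRadical R).ringCon.mk' : R →+ residueRing R).ker

lemma mem_J' [Finite R] [IsLocalRing R] {x : R} : x ∈ J R ↔ ¬ IsUnit x := by
  rw [← mem_J, ← TwoSidedIdeal.ker_ringCon_mk' (jacobsonRadical R), TwoSidedIdeal.mem_ker]
  exact Iff.rfl

lemma card_J : Nat.card R = Nat.card (residueRing R) * Nat.card (J R) := by
  rw [AddSubgroup.card_eq_card_quotient_mul_card_addSubgroup (J R)]
  congr 1
  exact Nat.card_congr (QuotientAddGroup.quotientKerEquivOfSurjective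
    ((jacobsonRadical R).ringCon.mk' : R →+ residueRing R)
    (RingCon.mk'_surjective _)).toEquiv

lemma ann_le_J [Finite R] [IsLocalRing R] {a : R} (ha : a ≠ 0) : ann a ≤ J R := by
  intro b hb
  rw [mem_J']
  intro hu
  exact ha ((hu.mul_left_eq_zero).1 (mem_ann.1 hb))

lemma card_range (a : R) :
    Nat.card R = Nat.card (AddMonoidHom.mulLeft a).range * Nat.card (ann a) := by
  rw [AddSubgroup.card_eq_card_quotient_mul_card_addSubgroup (ann a)]
  congr 1
  exact Nat.card_congr (QuotientAddGroup.quotientKerEquivRange _).toEquiv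

lemma card_ann_ge [Finite R] [IsLocalRing R] {a : R} (hu : ¬ IsUnit a) :
    Nat.card (residueRing R) ≤ Nat.card (ann a) := by
  have hx : ∃ x ≠ 0, a * x = 0 := by
    by_contra! hcon
    have inj : Function.Injective (fun b : R => a * b) := by
      intro b c hbc
      by_contra hne
      exact hcon (b - c) (sub_ne_zero.2 hne) (by rw [mul_sub, sub_eq_zero]; exact hbc)
    obtain ⟨b, hb⟩ := (Finite.injective_iff_surjective.1 inj) 1
    exact hu (isUnit_of_mul_one hb).1
  obtain ⟨x, hx0, hax⟩ := hx
  have h1 : (AddMonoidHom.mulLeft x).range ≤ ann a := by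
    rintro _ ⟨r, rfl⟩
    rw [mem_ann, AddMonoidHom.coe_mulLeft, ← mul_assoc, hax, zero_mul]
  have h2 := AddSubgroup.card_le_of_le h1
  have h3 := AddSubgroup.card_le_of_le (ann_le_J hx0)
  have h4 := card_range x
  rw [card_J] at h4
  have h5 : 0 < Nat.card (J R) := Nat.card_pos
  refine le_trans ?_ h2
  by_contra! hlt
  have : Nat.card (AddMonoidHom.mulLeft x).range * Nat.card (ann x)
      < Nat.card (residueRing R) * Nat.card (J R) :=
    lt_of_le_of_lt (Nat.mul_le_mul_left _ h3) (Nat.mul_lt_mul_of_pos_right hlt h5)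
  omega

lemma exists_socle [Finite R] [IsLocalRing R] (h : ∃ a : R, a ≠ 0 ∧ ¬ IsUnit a) :
    ∃ a : R, a ≠ 0 ∧ ¬ IsUnit a ∧ J R ≤ ann a := by
  obtain ⟨a, ⟨ha0, hau⟩, hmin⟩ := Set.exists_min_image {a : R | a ≠ 0 ∧ ¬ IsUnit a}
    (fun a => Nat.card (AddMonoidHom.mulLeft a).range) (Set.toFinite _) h
  refine ⟨a, ha0, hau, ?_⟩
  intro j hj
  rw [mem_J'] at hj
  rw [mem_ann]
  by_contra hne
  have hle : (AddMonoidHom.mulLeft (a * j)).range ≤ (AddMonoidHom.mulLeft a).range := by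
    rintro _ ⟨r, rfl⟩
    exact ⟨j * r, by simp [mul_assoc]⟩
  have hc := hmin (a * j) ⟨hne, fun hh => hau (isUnit_of_mul_left hh)⟩
  have heq := AddSubgroup.eq_of_le_of_card_ge hle hc
  have hmem : a ∈ (AddMonoidHom.mulLeft (a * j)).range := by
    rw [heq]; exact ⟨1, by simp⟩
  obtain ⟨r, hr⟩ := hmem
  have hr' : a * (1 - j * r) = 0 := by
    rw [AddMonoidHom.coe_mulLeft] at hr
    rw [mul_sub, ← mul_assoc, hr, mul_one, sub_self]
  rcases IsLocalRing.isUnit_or_isUnit_of_add_one (R := R) (a := 1 - j * r) (b := j * r)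
    (by abel) with h1 | h1
  · exact ha0 ((h1.mul_left_eq_zero).1 hr')
  · exact hj (isUnit_of_mul_left h1)

lemma card_pairs [Fintype R] :
    Nat.card {p : R × R // p.1 * p.2 = 0} = ∑ a : R, Nat.card (ann a) := by
  rw [Nat.card_congr (Equiv.subtypeProdEquivSigmaSubtype (fun a b : R => a * b = 0)),
    Nat.card_sigma]
  refine Finset.sum_congr rfl fun a _ => ?_
  exact Nat.card_congr (Equiv.subtypeEquivRight fun b => mem_ann.symm)

open Classical in
/-- lower bound for the size of the annihilator -/
noncomputable def g (q : ℕ) (a : R) : ℕ :=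
  if IsUnit a then 1 else if a = 0 then Nat.card R else q

lemma g_le [Finite R] [IsLocalRing R] (a : R) :
    g (Nat.card (residueRing R)) a ≤ Nat.card (ann a) := by
  unfold g
  split_ifs with h1 h2
  · exact Nat.card_pos
  · have : ann a = ⊤ := by
      ext b; simp [mem_ann, h2]
    rw [this]; simp
  · exact card_ann_ge h1

lemma sum_g [Fintype R] [IsLocalRing R] (q : ℕ) :
    (∑ a : R, g q a) + Nat.card (J R) + q = 2 * Nat.card R + q * Nat.card (J R) := by
  classical
  have hJ : Nat.card (J R) = (Finset.univ.filter fun a : R => ¬ IsUnit a).card := by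
    rw [← Fintype.card_subtype, ← Nat.card_eq_fintype_card]
    exact Nat.card_congr (Equiv.subtypeEquivRight fun b => mem_J')
  have hU := Finset.card_filter_add_card_filter_not (s := (Finset.univ : Finset R))
    (fun a : R => IsUnit a)
  rw [Finset.card_univ, ← Nat.card_eq_fintype_card, ← hJ] at hU
  have h0 : (0 : R) ∈ Finset.univ.filter fun a : R => ¬ IsUnit a := by simp
  have hs := Finset.sum_filter_add_sum_filter_not (Finset.univ : Finset R)
    (fun a : R => IsUnit a) (g q)
  have hs1 : ∑ a ∈ Finset.univ.filter (fun a : R => IsUnit a), g q a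
      = (Finset.univ.filter fun a : R => IsUnit a).card := by
    rw [Finset.card_eq_sum_ones]
    refine Finset.sum_congr rfl fun a ha => ?_
    simp [g, (Finset.mem_filter.1 ha).2]
  have hs2 : ∑ a ∈ Finset.univ.filter (fun a : R => ¬ IsUnit a), g q a + q
      = Nat.card R + q * Nat.card (J R) := by
    have hc := Finset.card_erase_add_one h0
    rw [← hJ] at hc
    rw [← Finset.add_sum_erase _ _ h0, ← hc]
    have : ∑ a ∈ (Finset.univ.filter fun a : R => ¬ IsUnit a).erase 0, g q a
        = ((Finset.univ.filter fun a : R => ¬ IsUnit a).erase 0).card * q := by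
      rw [Finset.sum_const_nat]
      intro a ha
      rw [Finset.mem_erase, Finset.mem_filter] at ha
      simp [g, ha.1, ha.2.2]
    rw [this]
    simp only [g, not_isUnit_zero, if_true, if_false]
    ring
  omega

lemma main_iff [Fintype R] [IsLocalRing R] {q n : ℕ} (hn : 2 ≤ n) (hq : 2 ≤ q)
    (hres : Nat.card (residueRing R) = q) (hJ : Nat.card (J R) = q ^ (n - 1)) :
    ∑ a : R, g q a = ∑ a : R, Nat.card (ann a) ↔ n = 2 := by
  rw [Finset.sum_eq_sum_iff_of_le (fun a _ => by rw [← hres]; exact g_le a)]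
  constructor
  · intro h
    have hne : ∃ a : R, a ≠ 0 ∧ ¬ IsUnit a := by
      have : Nontrivial (J R) := by
        rw [← Finite.one_lt_card_iff_nontrivial, hJ]
        exact Nat.one_lt_pow (by omega) (by omega)
      obtain ⟨x, hx⟩ := exists_ne (0 : J R)
      exact ⟨x, by simpa using hx, mem_J'.1 x.2⟩
    obtain ⟨a, ha0, hau, hle⟩ := exists_socle hne
    have h1 := h a (Finset.mem_univ _)
    rw [le_antisymm (ann_le_J ha0) hle, hJ] at h1
    simp only [g, hau, ha0, if_false] at h1
    have := Nat.pow_right_injective hq (a₁ := 1) (a₂ := n - 1) (by simpa using h1)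
    omega
  · rintro rfl a -
    refine le_antisymm (by rw [← hres]; exact g_le a) ?_
    unfold g
    split_ifs with h1 h2
    · have : ann a = ⊥ := by
        ext b; rw [mem_ann, h1.mul_right_eq_zero]; simp
      rw [this]; simp
    · exact Nat.card_le_card_of_injective _ Subtype.val_injective
    · have := AddSubgroup.card_le_of_le (ann_le_J h2)
      simpa [hJ] using this

end MulProbAux

/-- Let `R` be a finite local ring with `|R| = qⁿ`, `n ≥ 2`, whose residue
field `R/J` has `q` elements. Then `P_0(R) = (3q^{n−1} − q^{n−2} − 1)/q^{2n−1}` if and only if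
`|R| = q²`. -/
theorem mulProb_zero_lower_eq_iff_card_eq_sq
    {R : Type*} [Ring R] [Finite R] [IsLocalRing R] {q n : ℕ} (hn : 2 ≤ n)
    (hcard : Nat.card R = q ^ n) (hres : Nat.card (residueRing R) = q) :
    mulProb R 0 = (3 * (q : ℚ) ^ (n - 1) - (q : ℚ) ^ (n - 2) - 1) / (q : ℚ) ^ (2 * n - 1) ↔
      Nat.card R = q ^ 2 := by
  have := Fintype.ofFinite R
  have hR : 1 < Nat.card R := Finite.one_lt_card
  have hq : 2 ≤ q := by
    by_contra! h
    interval_cases q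
    · rw [hcard, zero_pow (by omega)] at hR; omega
    · rw [hcard, one_pow] at hR; omega
  have hJ : Nat.card (MulProbAux.J R) = q ^ (n - 1) := by
    have h := MulProbAux.card_J (R := R)
    rw [hcard, hres] at h
    obtain ⟨k, rfl⟩ : ∃ k, n = k + 1 := ⟨n - 1, by omega⟩
    rw [pow_succ'] at h
    exact (Nat.eq_of_mul_eq_mul_left (by omega) h).symm
  have hm := MulProbAux.main_iff hn hq hres hJ
  have hs := MulProbAux.sum_g (R := R) q
  have hrhs : Nat.card R = q ^ 2 ↔ n = 2 := by
    rw [hcard]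
    exact ⟨fun h => Nat.pow_right_injective hq h, fun h => by rw [h]⟩
  rw [hrhs, ← hm]
  unfold mulProb
  rw [MulProbAux.card_pairs]
  rw [hJ, hcard] at hs
  rw [hcard]
  generalize ∑ a : R, MulProbAux.g q a = G at hs ⊢
  generalize ∑ a : R, Nat.card (MulProbAux.ann a) = F
  obtain ⟨k, rfl⟩ : ∃ k, n = k + 2 := ⟨n - 2, by omega⟩
  have e1 : k + 2 - 1 = k + 1 := by omega
  have e2 : k + 2 - 2 = k := by omega
  have e3 : 2 * (k + 2) - 1 = 2 * k + 3 := by omega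
  rw [e1] at hs
  rw [e1, e2, e3]
  have hsQ : (G : ℚ) + (q : ℚ) ^ (k + 1) + q = 2 * (q : ℚ) ^ (k + 2) + q * (q : ℚ) ^ (k + 1) := by
    exact_mod_cast hs
  have hq0 : (q : ℚ) ≠ 0 := by
    have : q ≠ 0 := by omega
    exact_mod_cast this
  have hval : (3 * (q : ℚ) ^ (k + 1) - (q : ℚ) ^ k - 1) / (q : ℚ) ^ (2 * k + 3)
      = (G : ℚ) / ((q : ℚ) ^ (k + 2)) ^ 2 := by
    rw [div_eq_div_iff (pow_ne_zero _ hq0) (pow_ne_zero _ (pow_ne_zero _ hq0))]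
    have hG : (G : ℚ) = 2 * (q : ℚ) ^ (k + 2) + q * (q : ℚ) ^ (k + 1) - (q : ℚ) ^ (k + 1) - q := by
      linarith
    rw [hG]; ring
  rw [hval]
  push_cast
  rw [div_left_inj' (pow_ne_zero _ (pow_ne_zero _ hq0)), Nat.cast_inj]
  exact eq_comm
end

section
/- Let R be a finite local ring with identity, with |R| = q^n, whose residue field R/J has q elements, where J = J(R) is the Jacobson radical, and suppose J^{n−1} ≠ 0. If x ∈ J^k \ J^{k+1} for some integer k with 0 ≤ k ≤ n−1 (where J⁰ = R), then P_x(R) = ((k+1)(q−1))/q^{n+1}. -/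
open Pointwise in
/-- Powers of a two-sided ideal, as additive submonoids of `R`: `J⁰ = R`, `J¹ = J`, and
`J^(k+1) = J · J^k` (the product ideal). -/
def idealPow {R : Type*} [Ring R] (J : TwoSidedIdeal R) : ℕ → AddSubmonoid R
  | 0 => ⊤
  | 1 => J.asIdeal.toAddSubmonoid
  | (k + 2) => J.asIdeal.toAddSubmonoid * idealPow J (k + 1)

theorem mpA_pow {R : Type*} [Ring R] (J : TwoSidedIdeal R) (k : ℕ) :
    idealPow J k = (J.asIdeal ^ k).toAddSubmonoid := by
  induction k with
  | zero => rw [Submodule.pow_zero, Ideal.one_eq_top]; rfl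
  | succ k ih =>
    cases k with
    | zero => rw [zero_add, Submodule.pow_one]; rfl
    | succ k => rw [Ideal.IsTwoSided.pow_succ, idealPow, ih]; rfl

theorem mpA_mem {R : Type*} [Ring R] [Finite R] [IsLocalRing R] (x : R) :
    x ∈ (jacobsonRadical R).asIdeal ↔ ¬ IsUnit x := by
  rw [TwoSidedIdeal.asIdeal_jacobson, TwoSidedIdeal.bot_asIdeal]
  constructor
  · intro h hu
    have := Ideal.eq_top_of_isUnit_mem _ h hu
    rw [Ideal.jacobson_eq_top_iff] at this
    exact bot_ne_top this
  · intro h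
    rw [Ideal.mem_jacobson_iff]
    intro y
    have hyx : ¬ IsUnit (y * x) := by
      intro hu
      obtain ⟨u, hu⟩ := hu
      have : (↑u⁻¹ * y) * x = 1 := by rw [mul_assoc, ← hu]; simp
      exact h (IsUnit.of_mul_eq_one_right _ this)
    have h1 : IsUnit (y * x + 1) := by
      have h2 : -(y * x) + (y * x + 1) = 1 := by abel
      rcases IsLocalRing.isUnit_or_isUnit_of_add_one h2 with h3 | h3
      · exact absurd (by simpa using h3) hyx
      · exact h3
    obtain ⟨u, hu⟩ := h1
    refine ⟨↑u⁻¹, ?_⟩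
    have : (↑u⁻¹ : R) * (y * x + 1) = 1 := by rw [← hu]; simp
    rw [mul_add, mul_one, ← mul_assoc] at this
    rw [this]; simp

theorem mpA_index {R : Type*} [Ring R] [Finite R] (J : TwoSidedIdeal R) :
    (J.asIdeal.toAddSubgroup).index = Nat.card (J.ringCon.Quotient) := by
  have h : J.asIdeal.toAddSubgroup = (J.ringCon.mk' : R →+* _).toAddMonoidHom.ker := by
    ext x
    simp only [Submodule.mem_toAddSubgroup, TwoSidedIdeal.mem_asIdeal, AddMonoidHom.mem_ker]
    rw [TwoSidedIdeal.mem_iff]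
    exact (RingCon.eq J.ringCon).symm
  rw [h, AddSubgroup.index_ker, AddMonoidHom.range_eq_top.2 (RingCon.mk'_surjective J.ringCon)]
  exact Nat.card_congr AddSubgroup.topEquiv.toEquiv

section
set_option linter.unusedSectionVars false
variable {R : Type*} [Ring R] [Finite R] {I : Ideal R} [I.IsTwoSided]
  (hI : ∀ x, x ∈ I ↔ ¬ IsUnit x) (hnil : ∃ m, I ^ m = ⊥)

theorem mpA_anti {i j : ℕ} (h : i ≤ j) : I ^ j ≤ I ^ i := by
  obtain ⟨d, rfl⟩ := Nat.exists_eq_add_of_le h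
  rw [Ideal.IsTwoSided.pow_add]
  exact Ideal.mul_le_left

theorem mpA_mulI {i j : ℕ} {a b : R} (ha : a ∈ I ^ i) (hb : b ∈ I ^ j) : a * b ∈ I ^ (i + j) := by
  rw [Ideal.IsTwoSided.pow_add]
  exact Ideal.mul_mem_mul ha hb

include hI in
/-- relative index of `a R`. -/
theorem mpA_rel {i : ℕ} {a : R} (ha : a ∈ I ^ i) (ha' : a ∉ I ^ (i + 1)) :
    (I ^ (i + 1)).toAddSubgroup.relIndex (AddMonoidHom.mulLeft a).range
      = I.toAddSubgroup.index := by
  rw [← AddSubgroup.index_comap]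
  congr 1
  ext r
  simp only [AddSubgroup.mem_comap, Submodule.mem_toAddSubgroup, AddMonoidHom.coe_mulLeft]
  constructor
  · intro h
    rw [hI]
    rintro ⟨u, rfl⟩
    apply ha'
    have := Ideal.mul_mem_right (↑u⁻¹ : R) _ h
    simpa [mul_assoc] using this
  · intro h
    exact mpA_mulI ha (by simpa [Submodule.pow_one] using h)

theorem mpA_range_le {i : ℕ} {a : R} (ha : a ∈ I ^ i) :
    (AddMonoidHom.mulLeft a).range ≤ (I ^ i).toAddSubgroup := by
  rintro _ ⟨r, rfl⟩
  exact Ideal.mul_mem_right r _ ha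

theorem mpA_cardrel {G : Type*} [AddGroup G] {H K : AddSubgroup G} (h : H ≤ K) :
    Nat.card H * H.relIndex K = Nat.card K := by
  have := AddSubgroup.relIndex_mul_relIndex ⊥ H K bot_le h
  simpa [AddSubgroup.relIndex_bot_left] using this

include hI in
theorem mpA_step {i : ℕ} (h : I ^ i ≠ I ^ (i + 1)) :
    Nat.card (I ^ (i + 1)).toAddSubgroup * I.toAddSubgroup.index
      ≤ Nat.card (I ^ i).toAddSubgroup := by
  have hle : I ^ (i + 1) ≤ I ^ i := mpA_anti (Nat.le_succ i)
  obtain ⟨a, ha, ha'⟩ := SetLike.exists_of_lt (lt_of_le_of_ne hle h.symm)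
  rw [← mpA_cardrel (Submodule.toAddSubgroup_mono hle), ← mpA_rel hI ha ha']
  exact Nat.mul_le_mul_left _ (AddSubgroup.relIndex_le_of_le_right (mpA_range_le ha)
    (AddSubgroup.index_ne_zero_of_finite (H := AddSubgroup.addSubgroupOf _ _)))

include hnil in
theorem mpA_strict {i j : ℕ} (hij : i ≤ j) (hj : I ^ j ≠ ⊥) : I ^ i ≠ I ^ (i + 1) := by
  intro h
  have key : ∀ d, I ^ (i + d) = I ^ i := by
    intro d
    induction d with
    | zero => rfl
    | succ d ih =>
      rw [← add_assoc, Ideal.IsTwoSided.pow_succ, ih, ← Ideal.IsTwoSided.pow_succ, ← h]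
  obtain ⟨m, hm⟩ := hnil
  apply hj
  rw [eq_bot_iff]
  calc I ^ j ≤ I ^ i := mpA_anti hij
    _ = I ^ (i + m) := (key m).symm
    _ ≤ I ^ m := mpA_anti (by omega)
    _ = ⊥ := hm

variable {n q : ℕ} (hq : I.toAddSubgroup.index = q) (hcard : Nat.card R = q ^ n)
  (hn : 1 ≤ n) (hJ : I ^ (n - 1) ≠ ⊥)

include hI hnil hq hcard hn hJ in
theorem mpA_card {i : ℕ} (hi : i ≤ n) : Nat.card (I ^ i).toAddSubgroup = q ^ (n - i) := by
  have hq0 : 0 < q := by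
    rw [← hq]; exact Nat.pos_of_ne_zero AddSubgroup.index_ne_zero_of_finite
  have hst : ∀ i, i < n → Nat.card (I ^ (i + 1)).toAddSubgroup * q
      ≤ Nat.card (I ^ i).toAddSubgroup := by
    intro i hi
    rw [← hq]
    exact mpA_step hI (mpA_strict hnil (by omega : i ≤ n - 1) hJ)
  have up : ∀ i, i ≤ n → Nat.card (I ^ i).toAddSubgroup * q ^ i ≤ q ^ n := by
    intro i
    induction i with
    | zero =>
      intro _
      rw [← hcard, pow_zero, mul_one]
      exact Nat.card_le_card_of_injective _ Subtype.val_injective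
    | succ i ih =>
      intro hi
      calc _ = (Nat.card (I ^ (i + 1)).toAddSubgroup * q) * q ^ i := by ring
        _ ≤ _ := Nat.mul_le_mul_right _ (hst i (by omega))
        _ ≤ _ := ih (by omega)
  have down : ∀ d i, i + d = n → q ^ d ≤ Nat.card (I ^ i).toAddSubgroup := by
    intro d
    induction d with
    | zero => intro i _; rw [pow_zero]; exact Nat.card_pos
    | succ d ih =>
      intro i hi
      calc q ^ (d + 1) = q ^ d * q := pow_succ _ _
        _ ≤ _ := Nat.mul_le_mul_right _ (ih (i + 1) (by omega))
        _ ≤ _ := hst i (by omega)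
  apply le_antisymm
  · have := up i hi
    have e : q ^ n = q ^ (n - i) * q ^ i := by rw [← pow_add, Nat.sub_add_cancel hi]
    rw [e] at this
    exact Nat.le_of_mul_le_mul_right this (by positivity)
  · exact down _ _ (by omega)

include hI hnil hq hcard hn hJ in
theorem mpA_sup {i : ℕ} (hi : i < n) {a : R} (ha : a ∈ I ^ i) (ha' : a ∉ I ^ (i + 1)) {y : R}
    (hy : y ∈ I ^ i) : ∃ r, ∃ z ∈ I ^ (i + 1), y = a * r + z := by
  have hle : I ^ (i + 1) ≤ I ^ i := mpA_anti (Nat.le_succ i)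
  have hS : (AddMonoidHom.mulLeft a).range ⊔ (I ^ (i + 1)).toAddSubgroup
      = (I ^ i).toAddSubgroup := by
    apply AddSubgroup.eq_of_le_of_card_ge
    · exact sup_le (mpA_range_le ha) (Submodule.toAddSubgroup_mono hle)
    · rw [← mpA_cardrel (K := (AddMonoidHom.mulLeft a).range ⊔ (I ^ (i + 1)).toAddSubgroup)
        le_sup_right, AddSubgroup.relIndex_sup_right, mpA_rel hI ha ha', hq,
        mpA_card hI hnil hq hcard hn hJ hi.le, mpA_card hI hnil hq hcard hn hJ hi, ← pow_succ]
      exact le_of_eq (by congr 1; omega)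
  have : y ∈ (AddMonoidHom.mulLeft a).range ⊔ (I ^ (i + 1)).toAddSubgroup := by
    rw [hS]; exact hy
  obtain ⟨_, ⟨r, rfl⟩, z, hz, h⟩ := AddSubgroup.mem_sup.1 this
  exact ⟨r, z, hz, h.symm⟩

include hI hnil hq hcard hn hJ in
theorem mpA_range {i : ℕ} (hi : i < n) {a : R} (ha : a ∈ I ^ i) (ha' : a ∉ I ^ (i + 1)) :
    (AddMonoidHom.mulLeft a).range = (I ^ i).toAddSubgroup := by
  apply le_antisymm (mpA_range_le ha)
  have key : ∀ d, ∀ y ∈ I ^ i, ∃ r, ∃ z ∈ I ^ (i + d), y = a * r + z := by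
    intro d
    induction d with
    | zero => intro y hy; exact ⟨0, y, hy, by simp⟩
    | succ d ih =>
      have h2 : ∀ z ∈ I ^ (i + d), ∃ r, ∃ s ∈ I ^ (i + d + 1), z = a * r + s := by
        intro z hz
        rw [Ideal.IsTwoSided.pow_add] at hz
        refine Submodule.mul_induction_on hz ?_ ?_
        · intro u hu v hv
          obtain ⟨r, s, hs, rfl⟩ := mpA_sup hI hnil hq hcard hn hJ hi ha ha' hu
          refine ⟨r * v, s * v, ?_, by rw [add_mul, mul_assoc]⟩
          have := mpA_mulI hs hv
          exact mpA_anti (by omega) this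
        · rintro x y ⟨r, s, hs, rfl⟩ ⟨r', s', hs', rfl⟩
          exact ⟨r + r', s + s', add_mem hs hs', by rw [mul_add]; abel⟩
      intro y hy
      obtain ⟨r1, z1, hz1, h1⟩ := ih _ hy
      obtain ⟨r2, z2, hz2, rfl⟩ := h2 z1 hz1
      exact ⟨r1 + r2, z2, hz2, by rw [h1, mul_add]; abel⟩
  intro y hy
  obtain ⟨m, hm⟩ := hnil
  obtain ⟨r, z, hz, rfl⟩ := key m y hy
  have hz0 : z ∈ I ^ m := mpA_anti (by omega) hz
  rw [hm] at hz0
  have hz1 : z = 0 := by simpa using hz0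
  exact ⟨r, by simp [hz1]⟩

include hI hnil hq hcard hn hJ in
theorem mpA_fiber {i : ℕ} (hi : i < n) {a x : R} (ha : a ∈ I ^ i) (ha' : a ∉ I ^ (i + 1))
    (hx : x ∈ I ^ i) : Nat.card {b : R // a * b = x} = q ^ i := by
  have hq0 : 0 < q := by
    rw [← hq]; exact Nat.pos_of_ne_zero AddSubgroup.index_ne_zero_of_finite
  have hr := mpA_range hI hnil hq hcard hn hJ hi ha ha'
  have hx' : x ∈ (AddMonoidHom.mulLeft a).range := by rw [hr]; exact hx
  obtain ⟨b0, hb0⟩ := hx'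
  have hb0 : a * b0 = x := hb0
  have e : {b : R // a * b = x} ≃ (AddMonoidHom.mulLeft a).ker :=
    { toFun := fun b => ⟨b.1 - b0, by
        rw [AddMonoidHom.mem_ker, AddMonoidHom.coe_mulLeft, mul_sub, b.2, hb0, sub_self]⟩
      invFun := fun c => ⟨c.1 + b0, by
        have := c.2
        rw [AddMonoidHom.mem_ker, AddMonoidHom.coe_mulLeft] at this
        rw [mul_add, this, hb0, zero_add]⟩
      left_inv := fun b => by simp
      right_inv := fun c => by simp }
  rw [Nat.card_congr e]
  have h := (AddMonoidHom.mulLeft a).ker.card_mul_index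
  rw [AddSubgroup.index_ker, hr, mpA_card hI hnil hq hcard hn hJ hi.le, hcard] at h
  apply Nat.eq_of_mul_eq_mul_right (pow_pos hq0 (n - i))
  rw [h, ← pow_add]
  congr 1; omega

open Classical in
include hI hnil hq hcard hn hJ in
theorem mpA_sum [Fintype R] {k : ℕ} (hk : k < n) {x : R} (hx : x ∈ I ^ k) (m : ℕ)
    (hm : m ≤ k + 1) :
    ∑ a with a ∉ I ^ m, Nat.card {b : R // a * b = x} + m * q ^ (n - 1) = m * q ^ n := by
  induction m with
  | zero => simp [Submodule.pow_zero, Ideal.one_eq_top]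
  | succ m ih =>
    have hle : I ^ (m + 1) ≤ I ^ m := mpA_anti (Nat.le_succ m)
    have hsplit : (Finset.univ.filter fun a => a ∉ I ^ (m + 1))
        = (Finset.univ.filter fun a => a ∉ I ^ m) ∪
          ((Finset.univ.filter fun a => a ∈ I ^ m) \ (Finset.univ.filter fun a => a ∈ I ^ (m+1))) := by
      ext a
      simp only [Finset.mem_filter, Finset.mem_univ, true_and, Finset.mem_union, Finset.mem_sdiff]
      have := @hle a
      tauto
    have hc : ∀ j, j ≤ n → (Finset.univ.filter fun a => a ∈ I ^ j).card = q ^ (n - j) := by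
      intro j hj
      rw [← mpA_card hI hnil hq hcard hn hJ hj, ← Fintype.card_subtype, ← Nat.card_eq_fintype_card]
      rfl
    rw [hsplit, Finset.sum_union]
    · rw [Finset.sum_congr (s₁ := _ \ _) rfl (g := fun _ => q ^ m)]
      · rw [Finset.sum_const, smul_eq_mul]
        have h3 := Finset.card_sdiff_add_card_eq_card
          (s := Finset.univ.filter fun a => a ∈ I ^ (m+1))
          (t := Finset.univ.filter fun a => a ∈ I ^ m) (by
            intro a; simpa using @hle a)
        rw [hc m (by omega), hc (m + 1) (by omega)] at h3
        have h4 := congrArg (· * q ^ m) h3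
        simp only [add_mul, ← pow_add] at h4
        rw [show n - (m + 1) + m = n - 1 by omega, show n - m + m = n by omega] at h4
        have := ih (by omega)
        linarith
      · intro a ha
        simp only [Finset.mem_filter, Finset.mem_univ, true_and, Finset.mem_sdiff] at ha
        exact mpA_fiber hI hnil hq hcard hn hJ (by omega) ha.1 ha.2 (mpA_anti (by omega) hx)
    · rw [Finset.disjoint_left]
      intro a
      simp only [Finset.mem_filter, Finset.mem_univ, true_and, Finset.mem_sdiff]
      tauto

include hI hnil hq hcard hn hJ in
theorem mpA_count {k : ℕ} (hk : k < n) {x : R} (hx : x ∈ I ^ k) (hx' : x ∉ I ^ (k + 1)) :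
    Nat.card {p : R × R // p.1 * p.2 = x} + (k + 1) * q ^ (n - 1) = (k + 1) * q ^ n := by
  classical
  have := Fintype.ofFinite R
  rw [← mpA_sum hI hnil hq hcard hn hJ hk hx (k + 1) le_rfl]
  congr 1
  have e : {p : R × R // p.1 * p.2 = x} ≃ Σ a : R, {b : R // a * b = x} :=
    { toFun := fun p => ⟨p.1.1, p.1.2, p.2⟩
      invFun := fun s => ⟨(s.1, s.2.1), s.2.2⟩
      left_inv := fun _ => rfl
      right_inv := fun _ => rfl }
  rw [Nat.card_congr e, Nat.card_sigma]
  symm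
  apply Finset.sum_subset (Finset.subset_univ _)
  intro a _ ha
  have ha : a ∈ I ^ (k + 1) := by simpa using ha
  rw [Nat.card_eq_zero]
  left
  refine ⟨fun b => hx' ?_⟩
  rw [← b.2]
  exact Ideal.mul_mem_right _ _ ha

end

/-- Let `R` be a finite local ring with `|R| = qⁿ`, whose residue field
`R/J` has `q` elements, and suppose `J^{n−1} ≠ 0`. If `x ∈ J^k \ J^{k+1}` for some
`0 ≤ k ≤ n − 1` (with `J⁰ = R`), then `P_x(R) = (k+1)(q−1)/q^{n+1}`. -/
theorem mulProb_of_mem_pow_radical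
    {R : Type*} [Ring R] [Finite R] [IsLocalRing R] {q n : ℕ}
    (hcard : Nat.card R = q ^ n) (hres : Nat.card (residueRing R) = q)
    (hJ : idealPow (jacobsonRadical R) (n - 1) ≠ ⊥)
    (k : ℕ) (hk : k ≤ n - 1) (x : R)
    (hxk : x ∈ idealPow (jacobsonRadical R) k)
    (hxk1 : x ∉ idealPow (jacobsonRadical R) (k + 1)) :
    mulProb R x = ((k : ℚ) + 1) * ((q : ℚ) - 1) / (q : ℚ) ^ (n + 1) := by
  have hI := mpA_mem (R := R)
  have hnil : ∃ m, (jacobsonRadical R).asIdeal ^ m = ⊥ := by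
    rw [TwoSidedIdeal.asIdeal_jacobson, TwoSidedIdeal.bot_asIdeal]
    exact IsArtinianRing.isNilpotent_jacobson_bot
  have hq := (mpA_index (jacobsonRadical R)).trans hres
  have hn : 1 ≤ n := by
    rcases Nat.eq_zero_or_pos n with rfl | h
    · have := Finite.one_lt_card (α := R)
      rw [hcard] at this
      simp at this
    · exact h
  have hJ' : (jacobsonRadical R).asIdeal ^ (n - 1) ≠ ⊥ := by
    intro h
    apply hJ
    rw [mpA_pow, h]; rfl
  rw [mpA_pow] at hxk hxk1
  have hc := mpA_count hI hnil hq hcard hn hJ' (by omega : k < n) hxk hxk1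
  have hq0 : q ≠ 0 := by
    rw [← hq]; exact AddSubgroup.index_ne_zero_of_finite
  have hq1 : (q : ℚ) ≠ 0 := by exact_mod_cast hq0
  have hc' : (Nat.card {p : R × R // p.1 * p.2 = x} : ℚ) + (k + 1) * (q : ℚ) ^ (n - 1)
      = (k + 1) * (q : ℚ) ^ n := by exact_mod_cast hc
  obtain ⟨m, rfl⟩ := Nat.exists_eq_add_of_le' hn
  rw [mulProb, hcard, eq_sub_of_add_eq hc']
  push_cast
  field_simp
  ring
end

section
/- Let R be a finite local ring with identity, with |R| = q^n, whose residue field R/J has q elements, where J = J(R) is the Jacobson radical, and suppose J^{n−1} ≠ 0. Then for every i with 0 ≤ i ≤ n, the power ideal J^i has exactly q^{n−i} elements (where J⁰ = R). -/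
/-- Powers of the radical as left ideals. -/
def lpow (R : Type*) [Ring R] : ℕ → Ideal R
  | 0 => ⊤
  | (k + 1) => (jacobsonRadical R).asIdeal • lpow R k

lemma jac_eq (R : Type*) [Ring R] : (jacobsonRadical R).asIdeal = Ring.jacobson R := by
  rw [TwoSidedIdeal.asIdeal_jacobson, TwoSidedIdeal.bot_asIdeal, Ideal.jacobson_bot]

lemma lpow_one (R : Type*) [Ring R] : lpow R 1 = (jacobsonRadical R).asIdeal := by
  change (jacobsonRadical R).asIdeal • (⊤ : Ideal R) = _
  apply le_antisymm
  · rw [Submodule.smul_le]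
    intro r hr x _
    exact Ideal.mul_mem_right _ _ hr
  · intro x hx
    have := Submodule.smul_mem_smul hx (Submodule.mem_top (R := R) (x := (1 : R)))
    simpa using this

lemma lpow_eq (R : Type*) [Ring R] : ∀ k, (lpow R k).toAddSubmonoid = idealPow (jacobsonRadical R) k
  | 0 => rfl
  | 1 => by rw [lpow_one]; rfl
  | (k + 2) => by
    have ih := lpow_eq R (k + 1)
    rw [idealPow, ← ih]
    rfl

lemma left_inv_of_notMem {R : Type*} [Ring R] [Finite R] [IsLocalRing R] {r : R}
    (hr : r ∉ jacobsonRadical R) : ∃ s, s * r = 1 := by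
  rw [TwoSidedIdeal.mem_jacobson_iff] at hr
  push Not at hr
  obtain ⟨y, hy⟩ := hr
  rcases IsLocalRing.isUnit_or_isUnit_of_add_one (a := y * r + 1) (b := - (y * r)) (by abel) with h | h
  · obtain ⟨z, hz⟩ := h.exists_left_inv
    refine absurd ?_ (hy z)
    have : z * y * r + z - 1 = 0 := by
      rw [← hz]; noncomm_ring
    rw [this]
    exact zero_mem _
  · obtain ⟨z, hz⟩ := h.exists_left_inv
    exact ⟨-(z * y), by rw [← hz]; noncomm_ring⟩

lemma lpow_lt {R : Type*} [Ring R] [Finite R] {k : ℕ} (h : lpow R k ≠ ⊥) :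
    lpow R (k + 1) < lpow R k := by
  have := Submodule.FG.jacobson_smul_lt h (IsNoetherian.noetherian _)
  rw [← jac_eq] at this
  exact this

lemma card_step {R : Type*} [Ring R] [Finite R] [IsLocalRing R] {k : ℕ} (h : lpow R k ≠ ⊥) :
    Nat.card (residueRing R) * Nat.card (lpow R (k + 1)) ≤ Nat.card (lpow R k) := by
  have hlt := lpow_lt h
  obtain ⟨x, hx, hx'⟩ := SetLike.exists_of_lt hlt
  rw [← Nat.card_prod]
  have hsurj : Function.Surjective (fun r : R => (r : residueRing R)) := Quotient.mk_surjective
  choose f hf using hsurj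
  refine Nat.card_le_card_of_injective
    (fun p => (⟨f p.1 * x + p.2, add_mem (Ideal.mul_mem_left _ _ hx) (hlt.le p.2.2)⟩ : lpow R k)) ?_
  rintro ⟨a, y⟩ ⟨b, z⟩ hab
  simp only [Subtype.mk.injEq] at hab
  have hmem : (f a - f b) * x ∈ lpow R (k + 1) := by
    have : (f a - f b) * x = z - y := by
      rw [sub_mul, sub_eq_sub_iff_add_eq_add, hab, add_comm]
    rw [this]
    exact sub_mem z.2 y.2
  have hJ : f a - f b ∈ jacobsonRadical R := by
    by_contra hn
    obtain ⟨s, hs⟩ := left_inv_of_notMem hn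
    apply hx'
    have := Ideal.mul_mem_left _ s hmem
    rwa [← mul_assoc, hs, one_mul] at this
  have hab' : a = b := by
    rw [← hf a, ← hf b]
    exact (RingCon.eq _).2 ((TwoSidedIdeal.rel_iff _ _ _).2 hJ)
  subst hab'
  simpa using hab

/-- Let `R` be a finite local ring with `|R| = qⁿ`, whose residue field
`R/J` has `q` elements, and suppose `J^{n−1} ≠ 0`. Then for every `0 ≤ i ≤ n`, the power
ideal `J^i` has exactly `q^{n−i}` elements (with `J⁰ = R`). -/
theorem card_pow_radical
    {R : Type*} [Ring R] [Finite R] [IsLocalRing R] {q n : ℕ}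
    (hcard : Nat.card R = q ^ n) (hres : Nat.card (residueRing R) = q)
    (hJ : idealPow (jacobsonRadical R) (n - 1) ≠ ⊥) :
    ∀ i ≤ n, Nat.card (idealPow (jacobsonRadical R) i) = q ^ (n - i) := by
  intro i hi
  subst hres
  set q := Nat.card (residueRing R) with hq
  have hcd : ∀ k, Nat.card (idealPow (jacobsonRadical R) k) = Nat.card (lpow R k) := by
    intro k; rw [← lpow_eq]; rfl
  have hqpos : 0 < q := by
    have : Finite (residueRing R) := Quotient.finite _
    exact Nat.card_pos
  have hanti : Antitone (lpow R) := antitone_nat_of_succ_le fun k => Submodule.smul_le_right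
  have hn : lpow R (n - 1) ≠ ⊥ := by
    intro h
    apply hJ
    rw [← lpow_eq, h]; rfl
  have hne : ∀ k < n, lpow R k ≠ ⊥ := fun k hk h =>
    hn (le_bot_iff.1 (h ▸ hanti (by omega)))
  have hup : ∀ k ≤ n, q ^ k * Nat.card (lpow R k) ≤ q ^ n := by
    intro k
    induction k with
    | zero =>
      intro _
      rw [← hcard, pow_zero, one_mul]
      exact Nat.card_le_card_of_injective _ Subtype.val_injective
    | succ k ih =>
      intro hk
      refine le_trans ?_ (ih (by omega))
      rw [pow_succ, mul_assoc]
      exact Nat.mul_le_mul_left _ (card_step (hne k (by omega)))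
  have hlow : ∀ k ≤ n, q ^ k ≤ Nat.card (lpow R (n - k)) := by
    intro k
    induction k with
    | zero =>
      intro _
      rw [pow_zero]
      exact Nat.card_pos
    | succ k ih =>
      intro hk
      have h1 := card_step (hne (n - (k + 1)) (by omega))
      rw [show n - (k + 1) + 1 = n - k by omega] at h1
      refine le_trans ?_ h1
      rw [pow_succ, mul_comm]
      exact Nat.mul_le_mul_left _ (ih (by omega))
  rw [hcd]
  apply le_antisymm
  · have h := hup i hi
    rw [← Nat.add_sub_cancel' hi, pow_add] at h
    exact Nat.le_of_mul_le_mul_left h (pow_pos hqpos i)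
  · have h := hlow (n - i) (by omega)
    rwa [Nat.sub_sub_self hi] at h
end

section
/- Let R be a finite local ring with identity, with |R| = q^n, whose residue field R/J has q elements, where J = J(R) is the Jacobson radical, and suppose J^{n−1} ≠ 0. If x ∈ J^k \ J^{k+1} for some integer k with 0 ≤ k ≤ n−1 (where J⁰ = R), then xR = J^k and the right annihilator ann_r(x) = {y ∈ R : x*y = 0} equals J^{n−k}. -/
open Pointwise in
lemma ip_succ {R : Type*} [Ring R] (J : TwoSidedIdeal R) (k : ℕ) :
    idealPow J (k+1) = J.asIdeal.toAddSubmonoid * idealPow J k := by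
  cases k with
  | succ k => rfl
  | zero =>
    apply le_antisymm
    · intro x hx
      have := AddSubmonoid.mul_mem_mul (M := J.asIdeal.toAddSubmonoid) (N := idealPow J 0)
        (m := x) (n := 1) hx (AddSubmonoid.mem_top _)
      simpa using this
    · rw [AddSubmonoid.mul_le]
      intro m hm n _
      exact J.asIdeal.mul_mem_right n hm

open Pointwise in
lemma ip_mul_left {R : Type*} [Ring R] (J : TwoSidedIdeal R) (k : ℕ) (r x : R)
    (hx : x ∈ idealPow J k) : r * x ∈ idealPow J k := by
  cases k with
  | zero => exact AddSubmonoid.mem_top _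
  | succ k =>
    rw [ip_succ] at hx ⊢
    refine AddSubmonoid.mul_induction_on
      (C := fun x => r * x ∈ J.asIdeal.toAddSubmonoid * idealPow J k) hx ?_ ?_
    · intro m hm n hn
      rw [← mul_assoc]
      exact AddSubmonoid.mul_mem_mul (J.asIdeal.mul_mem_left r hm) hn
    · intro x y hx hy
      rw [mul_add]; exact add_mem hx hy

open Pointwise in
lemma ip_mul_right {R : Type*} [Ring R] (J : TwoSidedIdeal R) (k : ℕ) (r x : R)
    (hx : x ∈ idealPow J k) : x * r ∈ idealPow J k := by
  induction k generalizing x with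
  | zero => exact AddSubmonoid.mem_top _
  | succ k ih =>
    rw [ip_succ] at hx ⊢
    refine AddSubmonoid.mul_induction_on
      (C := fun x => x * r ∈ J.asIdeal.toAddSubmonoid * idealPow J k) hx ?_ ?_
    · intro m hm n hn
      rw [mul_assoc]
      exact AddSubmonoid.mul_mem_mul hm (ih n hn)
    · intro x y hx hy
      rw [add_mul]; exact add_mem hx hy

open Pointwise in
lemma ip_succ_le {R : Type*} [Ring R] (J : TwoSidedIdeal R) (k : ℕ) :
    idealPow J (k+1) ≤ idealPow J k := by
  rw [ip_succ, AddSubmonoid.mul_le]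
  intro m _ n hn
  exact ip_mul_left J k m n hn

open Pointwise in
lemma ip_add {R : Type*} [Ring R] (J : TwoSidedIdeal R) (a b : ℕ) :
    idealPow J (a+b) = idealPow J a * idealPow J b := by
  induction a with
  | zero =>
    rw [zero_add]
    apply le_antisymm
    · intro x hx
      have := AddSubmonoid.mul_mem_mul (M := idealPow J 0) (N := idealPow J b)
        (m := 1) (n := x) (AddSubmonoid.mem_top _) hx
      simpa using this
    · rw [AddSubmonoid.mul_le]
      intro m _ n hn
      exact ip_mul_left J b m n hn
  | succ a ih =>
    rw [show a + 1 + b = (a + b) + 1 by omega, ip_succ, ip_succ, ih, mul_assoc]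

/-- powers as additive subgroups -/
def ipg {R : Type*} [Ring R] (J : TwoSidedIdeal R) (k : ℕ) : AddSubgroup R :=
  { idealPow J k with
    neg_mem' := by
      intro x hx
      have := ip_mul_left J k (-1) x hx
      simpa using this }

lemma mem_ipg {R : Type*} [Ring R] {J : TwoSidedIdeal R} {k : ℕ} {x : R} :
    x ∈ ipg J k ↔ x ∈ idealPow J k := Iff.rfl

lemma ip_nil (R : Type*) [Ring R] [Finite R] :
    ∃ N, idealPow (jacobsonRadical R) N = ⊥ := by
  obtain ⟨N, hN⟩ := IsArtinianRing.isNilpotent_jacobson_bot (R := R)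
  have key : ∀ k, idealPow (jacobsonRadical R) (k+1) ≤
      ((Ideal.jacobson (⊥ : Ideal R)) ^ (k+1)).toAddSubmonoid := by
    intro k
    induction k with
    | zero =>
      intro x hx
      have : x ∈ (jacobsonRadical R).asIdeal := hx
      rw [TwoSidedIdeal.asIdeal_jacobson] at this
      rw [zero_add, Submodule.pow_one]
      simpa using this
    | succ k ih =>
      rw [ip_succ, AddSubmonoid.mul_le]
      intro m hm n hn
      rw [Submodule.pow_succ' _ (Nat.succ_ne_zero k)]
      apply Ideal.mul_mem_mul
      · have : m ∈ (jacobsonRadical R).asIdeal := hm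
        rw [TwoSidedIdeal.asIdeal_jacobson] at this
        simpa using this
      · exact ih hn
  refine ⟨N + 1, ?_⟩
  rw [eq_bot_iff]
  intro x hx
  have := key N hx
  rw [Submodule.pow_succ, hN] at this
  simpa using this

lemma unit_of_not_mem {R : Type*} [Ring R] [Finite R] [IsLocalRing R] {x : R}
    (hx : x ∉ jacobsonRadical R) : IsUnit x := by
  rw [TwoSidedIdeal.mem_jacobson_iff] at hx
  push Not at hx
  obtain ⟨y, hy⟩ := hx
  have h := IsLocalRing.isUnit_or_isUnit_of_add_one (a := -(y * x)) (b := 1 + y * x) (by abel)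
  rcases h with h | h
  · obtain ⟨u, hu⟩ := h
    have : (-(↑u⁻¹ * y)) * x = 1 := by
      rw [neg_mul, mul_assoc, ← mul_neg, ← hu]; simp
    exact IsUnit.of_mul_eq_one_right _ this
  · exfalso
    obtain ⟨u, hu⟩ := h
    apply hy ↑u⁻¹
    have : (↑u⁻¹ : R) * (1 + y * x) = 1 := by rw [← hu]; simp
    rw [TwoSidedIdeal.mem_bot, mul_assoc, sub_eq_zero, ← this, mul_add, mul_one, add_comm]

lemma index_J {R : Type*} [Ring R] :
    (ipg (jacobsonRadical R) 1).index = Nat.card (residueRing R) := by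
  let f : R →+ residueRing R := ((jacobsonRadical R).ringCon.mk').toAddMonoidHom
  have hf : Function.Surjective f := RingCon.mk'_surjective _
  have hk : f.ker = ipg (jacobsonRadical R) 1 := by
    ext x
    rw [AddMonoidHom.mem_ker]
    have : x ∈ ipg (jacobsonRadical R) 1 ↔ x ∈ jacobsonRadical R := Iff.rfl
    rw [this, TwoSidedIdeal.mem_iff]
    exact RingCon.eq _
  rw [← hk, AddSubgroup.index_ker, AddMonoidHom.range_eq_top.2 hf]
  simp

lemma step {G : Type*} [AddCommGroup G] (f : G →+ G) (K H J : AddSubgroup G)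
    (hKH : K ≤ H) (hf : ∀ r, f r ∈ H) (hJ : K.comap f = J) :
    J.index * (f.range ⊔ K).relIndex H = K.relIndex H := by
  rw [← AddSubgroup.relIndex_mul_relIndex K (f.range ⊔ K) H le_sup_right
    (sup_le (by rintro _ ⟨r, rfl⟩; exact hf r) hKH), AddSubgroup.relIndex_sup_right,
    ← hJ, AddSubgroup.index_comap]

/-- Let `R` be a finite local ring with `|R| = qⁿ`, whose residue field
`R/J` has `q` elements, and suppose `J^{n−1} ≠ 0`. If `x ∈ J^k \ J^{k+1}` for some
`0 ≤ k ≤ n − 1` (with `J⁰ = R`), then `xR = J^k` and `ann_r(x) = {y : x*y = 0} = J^{n−k}`. -/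
theorem range_mul_eq_pow_radical_and_annihilator_eq
    {R : Type*} [Ring R] [Finite R] [IsLocalRing R] {q n : ℕ}
    (hcard : Nat.card R = q ^ n) (hres : Nat.card (residueRing R) = q)
    (hJ : idealPow (jacobsonRadical R) (n - 1) ≠ ⊥)
    (k : ℕ) (hk : k ≤ n - 1) (x : R)
    (hxk : x ∈ idealPow (jacobsonRadical R) k)
    (hxk1 : x ∉ idealPow (jacobsonRadical R) (k + 1)) :
    {z : R | ∃ r : R, z = x * r} = (idealPow (jacobsonRadical R) k : Set R) ∧
    {y : R | x * y = 0} = (idealPow (jacobsonRadical R) (n - k) : Set R) := by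
  set J := jacobsonRadical R with hJd
  have hq : 0 < q := by
    rw [← hres, ← index_J]; exact Nat.pos_of_ne_zero AddSubgroup.index_ne_zero_of_finite
  have hn : 0 < n := by
    rcases Nat.eq_zero_or_pos n with h | h
    · subst h
      rw [pow_zero] at hcard
      have := Finite.one_lt_card (α := R)
      omega
    · exact h
  have hidx : (ipg J 1).index = q := index_J.trans hres
  have hle : ∀ i, ipg J (i+1) ≤ ipg J i := fun i => ip_succ_le J i
  have hanti : Antitone (idealPow J) := antitone_nat_of_succ_le (ip_succ_le J)
  have hmul : ∀ {a b : ℕ} {u v : R}, u ∈ idealPow J a → v ∈ idealPow J b →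
      u * v ∈ idealPow J (a + b) := by
    intro a b u v hu hv
    rw [ip_add]; exact AddSubmonoid.mul_mem_mul hu hv
  have hmem1 : ∀ r : R, r ∉ idealPow J 1 → IsUnit r := fun r hr => unit_of_not_mem hr
  obtain ⟨N, hN⟩ := ip_nil R
  have hne : ∀ i, i < n → ∃ y, y ∈ idealPow J i ∧ y ∉ idealPow J (i+1) := by
    intro i hi
    by_contra hcon
    push Not at hcon
    have heq : idealPow J i = idealPow J (i+1) := le_antisymm hcon (ip_succ_le J i)
    have hall : ∀ m, idealPow J (i + m) = idealPow J i := by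
      intro m
      induction m with
      | zero => rfl
      | succ m ih =>
        rw [show i + (m+1) = (i+1) + m by omega, ip_add, ← heq, ← ip_add, ih]
    apply hJ
    rw [eq_bot_iff, ← hN]
    calc idealPow J (n-1) ≤ idealPow J i := hanti (by omega)
      _ = idealPow J (i+N) := (hall N).symm
      _ ≤ idealPow J N := hanti (by omega)
  have hcs : ∀ i, (ipg J (i+1)).relIndex (ipg J i) * Nat.card (ipg J (i+1)) =
      Nat.card (ipg J i) := by
    intro i
    have := AddSubgroup.relIndex_mul_relIndex ⊥ (ipg J (i+1)) (ipg J i) bot_le (hle i)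
    rw [AddSubgroup.relIndex_bot_left, AddSubgroup.relIndex_bot_left] at this
    rw [mul_comm]; exact this
  have hpos : ∀ i, 0 < Nat.card (ipg J i) := fun i => Nat.card_pos
  have hge : ∀ i, i < n → q * Nat.card (ipg J (i+1)) ≤ Nat.card (ipg J i) := by
    intro i hi
    obtain ⟨y, hy, hy1⟩ := hne i hi
    have hs := step (AddMonoidHom.mulRight y) (ipg J (i+1)) (ipg J i) (ipg J 1) (hle i)
      (fun r => ip_mul_left J i r y hy) (by
        ext r
        constructor
        · intro h
          by_contra hr
          obtain ⟨u, rfl⟩ := hmem1 r hr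
          apply hy1
          have := ip_mul_left J (i+1) (↑u⁻¹) _ h
          simpa using this
        · intro h
          have := hmul h hy
          rw [add_comm] at this
          exact this)
    rw [hidx] at hs
    rw [← hcs i]
    apply Nat.mul_le_mul_right
    apply Nat.le_of_dvd
    · have := hpos i
      rw [← hcs i] at this
      exact Nat.pos_of_mul_pos_right this
    · exact ⟨_, hs.symm⟩
  have h0 : Nat.card (ipg J 0) = q ^ n := by
    rw [← hcard]
    have : ipg J 0 = ⊤ := by
      ext r; exact ⟨fun _ => trivial, fun _ => AddSubmonoid.mem_top r⟩
    rw [this]; simp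
  have hup : ∀ i, i ≤ n → q ^ i * Nat.card (ipg J i) ≤ q ^ n := by
    intro i
    induction i with
    | zero => intro _; rw [h0]; simp
    | succ i ih =>
      intro hi
      calc q ^ (i+1) * Nat.card (ipg J (i+1)) = q ^ i * (q * Nat.card (ipg J (i+1))) := by ring
        _ ≤ q ^ i * Nat.card (ipg J i) := Nat.mul_le_mul_left _ (hge i (by omega))
        _ ≤ q ^ n := ih (by omega)
  have hdown : ∀ m, m ≤ n → q ^ m ≤ Nat.card (ipg J (n - m)) := by
    intro m
    induction m with
    | zero => intro _; exact hpos _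
    | succ m ih =>
      intro hm
      have h1 := hge (n - (m+1)) (by omega)
      rw [show n - (m+1) + 1 = n - m by omega] at h1
      calc q ^ (m+1) = q * q ^ m := by ring
        _ ≤ q * Nat.card (ipg J (n - m)) := Nat.mul_le_mul_left _ (ih (by omega))
        _ ≤ _ := h1
  have hcd : ∀ i, i ≤ n → Nat.card (ipg J i) = q ^ (n - i) := by
    intro i hi
    apply le_antisymm
    · have h1 := hup i hi
      rw [show q ^ n = q ^ i * q ^ (n - i) by rw [← pow_add]; congr 1; omega] at h1
      exact Nat.le_of_mul_le_mul_left h1 (pow_pos hq i)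
    · have h1 := hdown (n - i) (by omega)
      rwa [show n - (n - i) = i by omega] at h1
  have hJn : ∀ r ∈ idealPow J n, r = 0 := by
    intro r hr
    have h1 := hcd n le_rfl
    rw [Nat.sub_self, pow_zero] at h1
    have h2 := AddSubgroup.eq_bot_of_card_eq _ h1
    have h3 : r ∈ ipg J n := hr
    rw [h2] at h3
    simpa using h3
  have hri : (ipg J (k+1)).relIndex (ipg J k) = q := by
    have h1 := hcs k
    rw [hcd k (by omega), hcd (k+1) (by omega),
      show n - k = (n - (k+1)) + 1 by omega, pow_succ'] at h1
    exact Nat.eq_of_mul_eq_mul_right (pow_pos hq _) h1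
  have hsup : ipg J k ≤ (AddMonoidHom.mulLeft x).range ⊔ ipg J (k+1) := by
    have hs := step (AddMonoidHom.mulLeft x) (ipg J (k+1)) (ipg J k) (ipg J 1) (hle k)
      (fun r => ip_mul_right J k r x hxk) (by
        ext r
        constructor
        · intro h
          by_contra hr
          obtain ⟨u, rfl⟩ := hmem1 r hr
          apply hxk1
          have := ip_mul_right J (k+1) (↑u⁻¹) _ h
          simpa using this
        · intro h
          exact hmul hxk h)
    rw [hidx, hri] at hs
    rw [← AddSubgroup.relIndex_eq_one]
    exact Nat.eq_of_mul_eq_mul_left hq (by rw [hs, mul_one])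
  have hstep : ∀ m, ∀ z ∈ idealPow J (k + m), ∃ r, z - x * r ∈ idealPow J (k + m + 1) := by
    intro m z hz
    rw [ip_add] at hz
    refine AddSubmonoid.mul_induction_on
      (C := fun z => ∃ r, z - x * r ∈ idealPow J (k + m + 1)) hz ?_ ?_
    · intro a ha b hb
      obtain ⟨c, ⟨r, rfl⟩, d, hd, hcd⟩ := AddSubgroup.mem_sup.1 (hsup ha)
      refine ⟨r * b, ?_⟩
      have h1 := hmul (mem_ipg.1 hd) hb
      rw [show k + 1 + m = k + m + 1 by omega] at h1
      rw [← hcd]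
      convert h1 using 1
      simp [add_mul, mul_assoc]
    · intro a b ha hb
      obtain ⟨r, hr⟩ := ha
      obtain ⟨s, hs⟩ := hb
      refine ⟨r + s, ?_⟩
      have h1 := add_mem hr hs
      convert h1 using 1
      rw [mul_add]; abel
  have hall : ∀ m, ∀ z ∈ idealPow J k, ∃ r, z - x * r ∈ idealPow J (k + m) := by
    intro m z hz
    induction m with
    | zero => exact ⟨0, by simpa using hz⟩
    | succ m ih =>
      obtain ⟨r, hr⟩ := ih
      obtain ⟨s, hs⟩ := hstep m _ hr
      refine ⟨r + s, ?_⟩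
      rw [mul_add, ← sub_sub]; exact hs
  have hrange : (AddMonoidHom.mulLeft x).range = ipg J k := by
    apply le_antisymm
    · rintro _ ⟨r, rfl⟩
      exact ip_mul_right J k r x hxk
    · intro z hz
      obtain ⟨r, hr⟩ := hall n z hz
      refine ⟨r, ?_⟩
      exact (sub_eq_zero.1 (hJn _ (hanti (by omega : n ≤ k + n) hr))).symm
  have hker : ipg J (n - k) = (AddMonoidHom.mulLeft x).ker := by
    apply AddSubgroup.eq_of_le_of_card_ge
    · intro y hy
      apply hJn
      have := hmul hxk (mem_ipg.1 hy)
      rwa [show k + (n - k) = n by omega] at this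
    · have h1 := AddSubgroup.card_mul_index (AddMonoidHom.mulLeft x).ker
      rw [AddSubgroup.index_ker, hrange, hcd k (by omega), hcard,
        show q ^ n = q ^ k * q ^ (n - k) by rw [← pow_add]; congr 1; omega] at h1
      rw [Nat.eq_of_mul_eq_mul_right (pow_pos hq _) h1, hcd (n-k) (by omega),
        show n - (n - k) = k by omega]
  constructor
  · ext z
    constructor
    · rintro ⟨r, rfl⟩
      exact ip_mul_right J k r x hxk
    · intro hz
      have : z ∈ ipg J k := hz
      rw [← hrange] at this
      obtain ⟨r, hr⟩ := this
      exact ⟨r, hr.symm⟩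
  · ext y
    have : y ∈ ipg J (n - k) ↔ y ∈ (AddMonoidHom.mulLeft x).ker := by rw [hker]
    exact this.symm
end
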